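/- arXiv:math-ph/0609039 — 9 statements merged into one kernel-verified Lean document; each statement's English description precedes it below -/
import Mathlib

section
/- Let σ ∈ ℝ be fixed. As functions on the phase space P one has, componentwise, {v(σ), H(σ)} = −v(σ)^⊥ (i.e. {v₁,H} = v₂ and {v₂,H} = −v₁) and {c(σ), H(σ)} = 0 (i.e. {c₁,H} = 0 and {c₂,H} = 0). -/
noncomputable section

/-- `w^⊥ = (-w₂, w₁)`. -/
def perp (w : ℝ × ℝ) : ℝ × ℝ := (-w.2, w.1)

/-- Poisson bracket `{f,g} = Σᵢ ∂_{qᵢ}f ∂_{pᵢ}g − ∂_{pᵢ}f ∂_{qᵢ}g` of two functions on the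
phase space `P ⊂ (ℝ²∖{0}) × ℝ²`, computed via Fréchet derivatives in coordinate directions. -/
def pb (f g : (ℝ × ℝ) × (ℝ × ℝ) → ℝ) (x : (ℝ × ℝ) × (ℝ × ℝ)) : ℝ :=
  fderiv ℝ f x ((1, 0), (0, 0)) * fderiv ℝ g x ((0, 0), (1, 0)) -
    fderiv ℝ f x ((0, 0), (1, 0)) * fderiv ℝ g x ((1, 0), (0, 0)) +
    (fderiv ℝ f x ((0, 1), (0, 0)) * fderiv ℝ g x ((0, 0), (0, 1)) -
      fderiv ℝ f x ((0, 0), (0, 1)) * fderiv ℝ g x ((0, 1), (0, 0)))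

/-- The vector potential `a(q) = (1/2)q^⊥ + a_E(q)`. -/
def aVec (aE : ℝ × ℝ → ℝ × ℝ) (q : ℝ × ℝ) : ℝ × ℝ := (1 / 2 : ℝ) • perp q + aE q

/-- The velocity `v(q,p) = p − a(q)`. -/
def vel (aE : ℝ × ℝ → ℝ × ℝ) (x : (ℝ × ℝ) × (ℝ × ℝ)) : ℝ × ℝ := x.2 - aVec aE x.1

/-- The center `c(q,p) = q − v(q,p)^⊥`. -/
def cen (aE : ℝ × ℝ → ℝ × ℝ) (x : (ℝ × ℝ) × (ℝ × ℝ)) : ℝ × ℝ := x.1 - perp (vel aE x)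

/-- The Hamiltonian `H(q,p) = (1/2)|p − a(q)|² = (1/2)|v|²`. -/
def ham (aE : ℝ × ℝ → ℝ × ℝ) (x : (ℝ × ℝ) × (ℝ × ℝ)) : ℝ :=
  (1 / 2 : ℝ) * ((vel aE x).1 ^ 2 + (vel aE x).2 ^ 2)

theorem hasFDerivAt_vel {aE : ℝ × ℝ → ℝ × ℝ} {x : (ℝ × ℝ) × (ℝ × ℝ)}
    (h : DifferentiableAt ℝ aE x.1) :
    HasFDerivAt (vel aE)
      (.snd ℝ (ℝ × ℝ) (ℝ × ℝ) -
        ((1 / 2 : ℝ) • (-ContinuousLinearMap.snd ℝ ℝ ℝ).prod (.fst ℝ ℝ ℝ) + fderiv ℝ aE x.1) ∘L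
          .fst ℝ (ℝ × ℝ) (ℝ × ℝ)) x := by
  have hperp : HasFDerivAt perp ((-ContinuousLinearMap.snd ℝ ℝ ℝ).prod (.fst ℝ ℝ ℝ)) x.1 :=
    hasFDerivAt_snd.neg.prodMk hasFDerivAt_fst
  exact hasFDerivAt_snd.sub
    (((hperp.const_smul (1 / 2 : ℝ)).add h.hasFDerivAt).comp x hasFDerivAt_fst)

theorem hasFDerivAt_ham {aE : ℝ × ℝ → ℝ × ℝ} {x : (ℝ × ℝ) × (ℝ × ℝ)}
    {V : (ℝ × ℝ) × (ℝ × ℝ) →L[ℝ] ℝ × ℝ} (hV : HasFDerivAt (vel aE) V x) :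
    HasFDerivAt (ham aE)
      ((vel aE x).1 • (.fst ℝ ℝ ℝ ∘L V) + (vel aE x).2 • (.snd ℝ ℝ ℝ ∘L V)) x := by
  refine (((hV.fst.pow 2).add (hV.snd.pow 2)).const_mul (1 / 2 : ℝ)).congr_fderiv ?_
  ext <;> simp <;> ring

/-- for fixed `σ` (a fixed smooth, rotation-free field `a_E`), on the phase space
`P = (ℝ²∖{0}) × ℝ²` one has, componentwise, `{v,H} = −v^⊥` (i.e. `{v₁,H} = v₂`,
`{v₂,H} = −v₁`) and `{c,H} = 0`. -/
theorem poisson_brackets_with_ham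
    (aE : ℝ × ℝ → ℝ × ℝ)
    (haE : ContDiffOn ℝ (⊤ : ℕ∞) aE {q : ℝ × ℝ | q ≠ 0})
    (hrot : ∀ q : ℝ × ℝ, q ≠ 0 →
      fderiv ℝ (fun y => (aE y).2) q (1, 0) - fderiv ℝ (fun y => (aE y).1) q (0, 1) = 0) :
    ∀ x : (ℝ × ℝ) × (ℝ × ℝ), x.1 ≠ 0 →
      pb (fun y => (vel aE y).1) (ham aE) x = (vel aE x).2 ∧
      pb (fun y => (vel aE y).2) (ham aE) x = -(vel aE x).1 ∧
      pb (fun y => (cen aE y).1) (ham aE) x = 0 ∧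
      pb (fun y => (cen aE y).2) (ham aE) x = 0 := by
  intro x hx
  have hd : DifferentiableAt ℝ aE x.1 :=
    (haE.contDiffAt (isOpen_ne.mem_nhds hx)).differentiableAt (by simp)
  have hr := hrot x.1 hx
  rw [hd.hasFDerivAt.snd.fderiv, hd.hasFDerivAt.fst.fderiv] at hr
  have hV := hasFDerivAt_vel hd
  have hH := hasFDerivAt_ham hV
  have hc₁ : HasFDerivAt (fun y => (cen aE y).1) _ x :=
    hasFDerivAt_fst.fst.sub hV.snd.neg
  have hc₂ : HasFDerivAt (fun y => (cen aE y).2) _ x :=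
    hasFDerivAt_fst.snd.sub hV.fst
  simp only [pb, hV.fst.fderiv, hV.snd.fderiv, hH.fderiv, hc₁.fderiv, hc₂.fderiv]
  have h₀ : fderiv ℝ aE x.1 (0, 0) = 0 := map_zero _
  simp [h₀] at hr ⊢
  refine ⟨?_, ?_, ?_, ?_⟩
  · linear_combination (vel aE x).2 * hr
  · linear_combination -(vel aE x).1 * hr
  · linear_combination -(vel aE x).1 * hr
  · linear_combination -(vel aE x).2 * hr
end
end

section
/- Fix σ ∈ ℝ and an initial point (q,p) ∈ P, and write c := c(σ;q,p), v := v(σ;q,p). Define the curves q(s) := c + (cos s)·v^⊥ + (sin s)·v and p(s) := (1/2)(c^⊥ + (cos s)·v − (sin s)·v^⊥) + a_E(σ; q(s)). Then on any interval of s-values containing 0 on which q(s) ≠ 0, the curve (q(s), p(s)) solves the frozen Hamiltonian equations ∂_s q(s) = (∂_p H(σ))(q(s),p(s)), ∂_s p(s) = −(∂_q H(σ))(q(s),p(s)) with initial condition (q(0), p(0)) = (q,p). -/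
noncomputable section

theorem fderiv_ham_apply {aE : ℝ × ℝ → ℝ × ℝ} {A : ℝ × ℝ →L[ℝ] ℝ × ℝ}
    {x : (ℝ × ℝ) × (ℝ × ℝ)} (hA : HasFDerivAt aE A x.1) (u w : ℝ × ℝ) :
    fderiv ℝ (ham aE) x (u, w) =
      (vel aE x).1 * (w.1 + u.2 / 2 - (A u).1) + (vel aE x).2 * (w.2 - u.1 / 2 - (A u).2) := by
  have hx1 : HasFDerivAt (fun y : (ℝ × ℝ) × (ℝ × ℝ) => y.1) (.fst ℝ _ _) x := hasFDerivAt_fst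
  have hx2 : HasFDerivAt (fun y : (ℝ × ℝ) × (ℝ × ℝ) => y.2) (.snd ℝ _ _) x := hasFDerivAt_snd
  have ha : HasFDerivAt (fun y : (ℝ × ℝ) × (ℝ × ℝ) => aE y.1) _ x := hA.comp x hx1
  have h1 : HasFDerivAt (fun y => (vel aE y).1) _ x :=
    (hx2.fst.sub ((hx1.snd.neg.const_mul (1 / 2)).add ha.fst)).congr_of_eventuallyEq
      (.of_forall fun y => by simp [vel, aVec, perp])
  have h2 : HasFDerivAt (fun y => (vel aE y).2) _ x :=
    (hx2.snd.sub ((hx1.fst.const_mul (1 / 2)).add ha.snd)).congr_of_eventuallyEq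
      (.of_forall fun y => by simp [vel, aVec, perp])
  have h : HasFDerivAt (ham aE) _ x := ((h1.pow 2).add (h2.pow 2)).const_mul (1 / 2)
  rw [h.fderiv]
  simp
  ring

/-- fix `σ` (a fixed smooth, rotation-free field `a_E`) and an initial point
`(q,p) ∈ P`; put `c := c(q,p)`, `v := v(q,p)`. Then the curves
`q(s) = c + cos s · v^⊥ + sin s · v` and
`p(s) = (1/2)(c^⊥ + cos s · v − sin s · v^⊥) + a_E(q(s))`
solve the frozen Hamiltonian equations `q̇ = ∂_p H`, `ṗ = −∂_q H` with `(q(0),p(0)) = (q,p)`,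
on any interval `I ∋ 0` on which `q(s) ≠ 0`. -/
theorem frozen_flow_solution
    (aE : ℝ × ℝ → ℝ × ℝ)
    (haE : ContDiffOn ℝ (⊤ : ℕ∞) aE {q : ℝ × ℝ | q ≠ 0})
    (hrot : ∀ q : ℝ × ℝ, q ≠ 0 →
      fderiv ℝ (fun y => (aE y).2) q (1, 0) - fderiv ℝ (fun y => (aE y).1) q (0, 1) = 0)
    (q p : ℝ × ℝ) (hq : q ≠ 0)
    (qc pc : ℝ → ℝ × ℝ)
    (hqc : ∀ s, qc s = cen aE (q, p) + Real.cos s • perp (vel aE (q, p)) +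
        Real.sin s • vel aE (q, p))
    (hpc : ∀ s, pc s = (1 / 2 : ℝ) • (perp (cen aE (q, p)) + Real.cos s • vel aE (q, p) -
        Real.sin s • perp (vel aE (q, p))) + aE (qc s))
    (I : Set ℝ) (hI : I.OrdConnected) (h0 : (0 : ℝ) ∈ I)
    (hne : ∀ s ∈ I, qc s ≠ 0) :
    qc 0 = q ∧ pc 0 = p ∧
    ∀ s ∈ I,
      HasDerivWithinAt qc
        (fderiv ℝ (ham aE) (qc s, pc s) ((0, 0), (1, 0)),
         fderiv ℝ (ham aE) (qc s, pc s) ((0, 0), (0, 1))) I s ∧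
      HasDerivWithinAt pc
        (-fderiv ℝ (ham aE) (qc s, pc s) ((1, 0), (0, 0)),
         -fderiv ℝ (ham aE) (qc s, pc s) ((0, 1), (0, 0))) I s := by
  have hvel : ∀ s, vel aE (qc s, pc s) =
      Real.cos s • vel aE (q, p) - Real.sin s • perp (vel aE (q, p)) := by
    intro s
    rw [vel, aVec, hpc s]
    ext <;> simp [hqc s, perp] <;> ring
  have hq0 : qc 0 = q := by simp [hqc, cen]
  refine ⟨hq0, ?_, fun s hs => ?_⟩
  · rw [hpc 0, hq0]
    ext <;> simp [cen, vel, aVec, perp] <;> ring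
  have hA : HasFDerivAt aE (fderiv ℝ aE (qc s)) (qc s) :=
    ((haE.contDiffAt (isOpen_ne.mem_nhds (hne s hs))).differentiableAt (by simp)).hasFDerivAt
  have hr := hrot (qc s) (hne s hs)
  rw [hA.snd.fderiv, hA.fst.fderiv] at hr
  simp only [ContinuousLinearMap.comp_apply, ContinuousLinearMap.coe_fst',
    ContinuousLinearMap.coe_snd'] at hr
  simp only [fderiv_ham_apply (x := (qc s, pc s)) hA, hvel s]
  have hqd : HasDerivAt qc
      (Real.cos s • vel aE (q, p) - Real.sin s • perp (vel aE (q, p))) s := by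
    rw [funext hqc]
    refine ((((Real.hasDerivAt_cos s).smul_const _).const_add _).add
      ((Real.hasDerivAt_sin s).smul_const _)).congr_deriv ?_
    module
  have had : HasDerivAt (fun t => aE (qc t)) _ s := hA.comp_hasDerivAt s hqd
  have hpd := (((((Real.hasDerivAt_cos s).smul_const (vel aE (q, p))).const_add
    (perp (cen aE (q, p)))).sub ((Real.hasDerivAt_sin s).smul_const
      (perp (vel aE (q, p))))).const_smul (1 / 2 : ℝ) |>.add had).congr_of_eventuallyEq
        (.of_forall hpc)
  have hlin : ∀ w : ℝ × ℝ, fderiv ℝ aE (qc s) w =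
      w.1 • fderiv ℝ aE (qc s) (1, 0) + w.2 • fderiv ℝ aE (qc s) (0, 1) := by
    intro w
    rw [← map_smul, ← map_smul, ← map_add]
    simp
  refine ⟨(hqd.congr_deriv ?_).hasDerivWithinAt, (hpd.congr_deriv ?_).hasDerivWithinAt⟩
  · ext <;> simp [hlin (0, 0)]
  · rw [hlin (_ - _)]
    ext
    · simp [perp]
      linear_combination
        -(Real.cos s * (vel aE (q, p)).2 - Real.sin s * (vel aE (q, p)).1) * hr
    · simp [perp]
      linear_combination
        (Real.cos s * (vel aE (q, p)).1 + Real.sin s * (vel aE (q, p)).2) * hr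
end
end

section
/- Fix σ ∈ ℝ. On the open subset of phase space P where v(σ) ≠ 0 and c(σ) ≠ 0, define the functions I₁ := |c(σ)|²/2, I₂ := H(σ), u₁ := c(σ)/|c(σ)| (with components u₁,₁, u₁,₂) and u₂ := v(σ)^⊥/|v(σ)| (with components u₂,₁, u₂,₂). Then the following Poisson bracket identities hold: {I₁, I₂} = 0; {u₁,ᵢ, u₂,ⱼ} = 0 for all i,j ∈ {1,2}; {I₁, u₂,ⱼ} = 0 and {I₂, u₁,ᵢ} = 0 for all i,j; and componentwise {u₁, I₁} = u₁^⊥ and {u₂, I₂} = −u₂^⊥. (These identities express that the transformation T(σ) to action-angle coordinates, in which u₁ = e(φ₁) and u₂ = e(−φ₂), is canonical: {φ₁,I₁} = {φ₂,I₂} = 1 with all other brackets of the coordinates vanishing.) -/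
noncomputable section

/-- Euclidean norm on `ℝ²`. -/
def nrm (w : ℝ × ℝ) : ℝ := Real.sqrt (w.1 ^ 2 + w.2 ^ 2)

/-- The Hamiltonian (= second action) `I₂ = H = (1/2)|v|²`. -/
def actI₂ (aE : ℝ × ℝ → ℝ × ℝ) (x : (ℝ × ℝ) × (ℝ × ℝ)) : ℝ :=
  (1 / 2 : ℝ) * ((vel aE x).1 ^ 2 + (vel aE x).2 ^ 2)

/-- The first action `I₁ = |c|²/2`. -/
def actI₁ (aE : ℝ × ℝ → ℝ × ℝ) (x : (ℝ × ℝ) × (ℝ × ℝ)) : ℝ :=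
  ((cen aE x).1 ^ 2 + (cen aE x).2 ^ 2) / 2

/-- The unit vector `u₁ = c/|c| = e(φ₁)`. -/
def unit₁ (aE : ℝ × ℝ → ℝ × ℝ) (x : (ℝ × ℝ) × (ℝ × ℝ)) : ℝ × ℝ :=
  (nrm (cen aE x))⁻¹ • cen aE x

/-- The unit vector `u₂ = v^⊥/|v| = e(−φ₂)`. -/
def unit₂ (aE : ℝ × ℝ → ℝ × ℝ) (x : (ℝ × ℝ) × (ℝ × ℝ)) : ℝ × ℝ :=
  (nrm (vel aE x))⁻¹ • perp (vel aE x)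

/-- The canonical Poisson pairing of two covectors on phase space. -/
def covectorBracket (F G : (ℝ × ℝ) × (ℝ × ℝ) →L[ℝ] ℝ) : ℝ :=
  F ((1, 0), (0, 0)) * G ((0, 0), (1, 0)) - F ((0, 0), (1, 0)) * G ((1, 0), (0, 0)) +
    (F ((0, 1), (0, 0)) * G ((0, 0), (0, 1)) - F ((0, 0), (0, 1)) * G ((0, 1), (0, 0)))

theorem pb_eq_covectorBracket {f g : (ℝ × ℝ) × (ℝ × ℝ) → ℝ} {x : (ℝ × ℝ) × (ℝ × ℝ)}
    {F G : (ℝ × ℝ) × (ℝ × ℝ) →L[ℝ] ℝ} (hf : HasFDerivAt f F x) (hg : HasFDerivAt g G x) :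
    pb f g x = covectorBracket F G := by
  rw [pb, hf.fderiv, hg.fderiv, covectorBracket]

theorem covectorBracket_comb (F₁ F₂ G₁ G₂ : (ℝ × ℝ) × (ℝ × ℝ) →L[ℝ] ℝ) (a₁ a₂ b₁ b₂ : ℝ) :
    covectorBracket (a₁ • F₁ + a₂ • F₂) (b₁ • G₁ + b₂ • G₂) =
      a₁ * b₁ * covectorBracket F₁ G₁ + a₁ * b₂ * covectorBracket F₁ G₂ +
        (a₂ * b₁ * covectorBracket F₂ G₁ + a₂ * b₂ * covectorBracket F₂ G₂) := by
  simp only [covectorBracket, add_apply, smul_apply,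
    smul_eq_mul]
  ring

theorem covectorBracket_swap (F G : (ℝ × ℝ) × (ℝ × ℝ) →L[ℝ] ℝ) :
    covectorBracket F G = -covectorBracket G F := by
  simp only [covectorBracket]
  ring

theorem covectorBracket_self (F : (ℝ × ℝ) × (ℝ × ℝ) →L[ℝ] ℝ) : covectorBracket F F = 0 := by
  simp only [covectorBracket]
  ring

theorem sq_add_sq_pos_of_ne_zero {w : ℝ × ℝ} (hw : w ≠ 0) : 0 < w.1 ^ 2 + w.2 ^ 2 := by
  by_contra! h
  exact hw (Prod.ext (by simp only [Prod.fst_zero]; nlinarith [sq_nonneg w.1, sq_nonneg w.2])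
    (by simp only [Prod.snd_zero]; nlinarith [sq_nonneg w.1, sq_nonneg w.2]))

theorem nrm_pos {w : ℝ × ℝ} (hw : w ≠ 0) : 0 < nrm w :=
  Real.sqrt_pos.2 (sq_add_sq_pos_of_ne_zero hw)

theorem nrm_sq (w : ℝ × ℝ) : nrm w ^ 2 = w.1 ^ 2 + w.2 ^ 2 :=
  Real.sq_sqrt (by positivity)

section Normalization

variable {E : Type*} [NormedAddCommGroup E] [NormedSpace ℝ E] {w : E → ℝ × ℝ} {x : E}
  {F G : E →L[ℝ] ℝ}

theorem hasFDerivAt_half_sq_add_sq (hF : HasFDerivAt (fun y => (w y).1) F x)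
    (hG : HasFDerivAt (fun y => (w y).2) G x) :
    HasFDerivAt (fun y => ((w y).1 ^ 2 + (w y).2 ^ 2) / 2) ((w x).1 • F + (w x).2 • G) x := by
  have h := ((hF.pow 2).add (hG.pow 2)).mul_const (2 : ℝ)⁻¹
  refine (h.congr_fderiv ?_).congr_of_eventuallyEq (.of_forall fun y => div_eq_mul_inv _ _)
  ext z
  simp
  ring

theorem hasFDerivAt_inv_nrm (hF : HasFDerivAt (fun y => (w y).1) F x)
    (hG : HasFDerivAt (fun y => (w y).2) G x) (hw : w x ≠ 0) :
    HasFDerivAt (fun y => (nrm (w y))⁻¹)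
      (-(nrm (w x) ^ 3)⁻¹ • ((w x).1 • F + (w x).2 • G)) x := by
  have hr := nrm_pos hw
  have hs : HasFDerivAt (fun y => nrm (w y)) _ x :=
    ((hF.pow 2).add (hG.pow 2)).sqrt (sq_add_sq_pos_of_ne_zero hw).ne'
  have h := (hasDerivAt_inv hr.ne').comp_hasFDerivAt x hs
  refine h.congr_fderiv ?_
  ext z
  have : √((w x).1 ^ 2 + (w x).2 ^ 2) = nrm (w x) := rfl
  simp [this]
  field_simp

theorem hasFDerivAt_normalize_fst (hF : HasFDerivAt (fun y => (w y).1) F x)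
    (hG : HasFDerivAt (fun y => (w y).2) G x) (hw : w x ≠ 0) :
    HasFDerivAt (fun y => (nrm (w y))⁻¹ * (w y).1)
      (((nrm (w x) ^ 3)⁻¹ * (w x).2 ^ 2) • F +
        (-((nrm (w x) ^ 3)⁻¹ * ((w x).1 * (w x).2))) • G) x := by
  have hr := nrm_pos hw
  refine ((hasFDerivAt_inv_nrm hF hG hw).mul hF).congr_fderiv ?_
  ext z
  simp
  field_simp
  linear_combination (F z) * nrm_sq (w x)

theorem hasFDerivAt_normalize_snd (hF : HasFDerivAt (fun y => (w y).1) F x)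
    (hG : HasFDerivAt (fun y => (w y).2) G x) (hw : w x ≠ 0) :
    HasFDerivAt (fun y => (nrm (w y))⁻¹ * (w y).2)
      ((-((nrm (w x) ^ 3)⁻¹ * ((w x).1 * (w x).2))) • F +
        ((nrm (w x) ^ 3)⁻¹ * (w x).1 ^ 2) • G) x := by
  have hr := nrm_pos hw
  refine ((hasFDerivAt_inv_nrm hF hG hw).mul hG).congr_fderiv ?_
  ext z
  simp
  field_simp
  linear_combination (G z) * nrm_sq (w x)

end Normalization

/-- The components of `v` and `c` are differentiable, and `c` Poisson-commutes with `v`, while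
`{v₁, v₂} = 1` and `{c₁, c₂} = -1`. -/
theorem exists_hasFDerivAt_vel_cen {aE : ℝ × ℝ → ℝ × ℝ} {x : (ℝ × ℝ) × (ℝ × ℝ)}
    (haE : DifferentiableAt ℝ aE x.1)
    (hrot : fderiv ℝ (fun y => (aE y).2) x.1 (1, 0) -
      fderiv ℝ (fun y => (aE y).1) x.1 (0, 1) = 0) :
    ∃ V₁ V₂ C₁ C₂ : (ℝ × ℝ) × (ℝ × ℝ) →L[ℝ] ℝ,
      HasFDerivAt (fun y => (vel aE y).1) V₁ x ∧ HasFDerivAt (fun y => (vel aE y).2) V₂ x ∧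
      HasFDerivAt (fun y => (cen aE y).1) C₁ x ∧ HasFDerivAt (fun y => (cen aE y).2) C₂ x ∧
      covectorBracket V₁ V₂ = 1 ∧ covectorBracket C₁ C₂ = -1 ∧
      covectorBracket C₁ V₁ = 0 ∧ covectorBracket C₁ V₂ = 0 ∧
      covectorBracket C₂ V₁ = 0 ∧ covectorBracket C₂ V₂ = 0 := by
  have hz (F : ℝ × ℝ →L[ℝ] ℝ) : F (0, 0) = 0 := F.map_zero
  have hq : HasFDerivAt (fun y : (ℝ × ℝ) × (ℝ × ℝ) => y.1) _ x :=
    hasFDerivAt_fst (𝕜 := ℝ)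
  have hp : HasFDerivAt (fun y : (ℝ × ℝ) × (ℝ × ℝ) => y.2) _ x :=
    hasFDerivAt_snd (𝕜 := ℝ)
  have ha₁ := haE.fst.hasFDerivAt.comp x hq
  have ha₂ := haE.snd.hasFDerivAt.comp x hq
  have hV₁ := hp.fst.sub ((hq.snd.neg.const_mul (1 / 2)).add ha₁)
  have hV₂ := hp.snd.sub ((hq.fst.const_mul (1 / 2)).add ha₂)
  refine ⟨_, _, _, _, hV₁, hV₂, hq.fst.sub hV₂.neg, hq.snd.sub hV₁, ?_, ?_, ?_, ?_, ?_, ?_⟩ <;>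
  · simp [covectorBracket, hz]
    try linarith

/-- on the open set where `v ≠ 0` and `c ≠ 0` the Poisson brackets of the
action-angle data satisfy `{I₁,I₂} = 0`, `{u₁ᵢ,u₂ⱼ} = 0`, `{I₁,u₂ⱼ} = 0`, `{I₂,u₁ᵢ} = 0`,
`{u₁,I₁} = u₁^⊥` and `{u₂,I₂} = −u₂^⊥` (componentwise); i.e. `T(σ)` is canonical. -/
theorem action_angle_brackets
    (aE : ℝ × ℝ → ℝ × ℝ)
    (haE : ContDiffOn ℝ (⊤ : ℕ∞) aE {q : ℝ × ℝ | q ≠ 0})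
    (hrot : ∀ q : ℝ × ℝ, q ≠ 0 →
      fderiv ℝ (fun y => (aE y).2) q (1, 0) - fderiv ℝ (fun y => (aE y).1) q (0, 1) = 0) :
    ∀ x : (ℝ × ℝ) × (ℝ × ℝ), x.1 ≠ 0 → vel aE x ≠ 0 → cen aE x ≠ 0 →
      pb (actI₁ aE) (actI₂ aE) x = 0 ∧
      pb (fun y => (unit₁ aE y).1) (fun y => (unit₂ aE y).1) x = 0 ∧
      pb (fun y => (unit₁ aE y).1) (fun y => (unit₂ aE y).2) x = 0 ∧
      pb (fun y => (unit₁ aE y).2) (fun y => (unit₂ aE y).1) x = 0 ∧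
      pb (fun y => (unit₁ aE y).2) (fun y => (unit₂ aE y).2) x = 0 ∧
      pb (actI₁ aE) (fun y => (unit₂ aE y).1) x = 0 ∧
      pb (actI₁ aE) (fun y => (unit₂ aE y).2) x = 0 ∧
      pb (actI₂ aE) (fun y => (unit₁ aE y).1) x = 0 ∧
      pb (actI₂ aE) (fun y => (unit₁ aE y).2) x = 0 ∧
      pb (fun y => (unit₁ aE y).1) (actI₁ aE) x = (perp (unit₁ aE x)).1 ∧
      pb (fun y => (unit₁ aE y).2) (actI₁ aE) x = (perp (unit₁ aE x)).2 ∧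
      pb (fun y => (unit₂ aE y).1) (actI₂ aE) x = -(perp (unit₂ aE x)).1 ∧
      pb (fun y => (unit₂ aE y).2) (actI₂ aE) x = -(perp (unit₂ aE x)).2 := by
  intro x hx hv hc
  obtain ⟨V₁, V₂, C₁, C₂, hV₁, hV₂, hC₁, hC₂, hVV, hCC, h₁₁, h₁₂, h₂₁, h₂₂⟩ :=
    exists_hasFDerivAt_vel_cen
      ((haE.contDiffAt (isOpen_ne.mem_nhds hx)).differentiableAt (by simp)) (hrot x.1 hx)
  have hI₁ : HasFDerivAt (actI₁ aE) _ x := hasFDerivAt_half_sq_add_sq hC₁ hC₂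
  have hI₂ : HasFDerivAt (actI₂ aE) _ x :=
    (hasFDerivAt_half_sq_add_sq hV₁ hV₂).congr_of_eventuallyEq
      (.of_forall fun y => by simp only [actI₂]; ring)
  have hu₁₁ : HasFDerivAt (fun y => (unit₁ aE y).1) _ x := hasFDerivAt_normalize_fst hC₁ hC₂ hc
  have hu₁₂ : HasFDerivAt (fun y => (unit₁ aE y).2) _ x := hasFDerivAt_normalize_snd hC₁ hC₂ hc
  have hu₂₁ : HasFDerivAt (fun y => (unit₂ aE y).1)
      (((nrm (vel aE x) ^ 3)⁻¹ * ((vel aE x).1 * (vel aE x).2)) • V₁ +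
        (-((nrm (vel aE x) ^ 3)⁻¹ * (vel aE x).1 ^ 2)) • V₂) x := by
    refine ((hasFDerivAt_normalize_snd hV₁ hV₂ hv).neg.congr_fderiv (by module)
      ).congr_of_eventuallyEq (.of_forall fun y => ?_)
    simp [unit₂, perp]
  have hu₂₂ : HasFDerivAt (fun y => (unit₂ aE y).2) _ x := hasFDerivAt_normalize_fst hV₁ hV₂ hv
  have hCC' : covectorBracket C₂ C₁ = 1 := by rw [covectorBracket_swap, hCC, neg_neg]
  have hVV' : covectorBracket V₂ V₁ = -1 := by rw [covectorBracket_swap, hVV]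
  have hrc := nrm_pos hc
  have hrv := nrm_pos hv
  have hsc := nrm_sq (cen aE x)
  have hsv := nrm_sq (vel aE x)
  refine ⟨?_, ?_, ?_, ?_, ?_, ?_, ?_, ?_, ?_, ?_, ?_, ?_, ?_⟩
  · simp [pb_eq_covectorBracket hI₁ hI₂, covectorBracket_comb, h₁₁, h₁₂, h₂₁, h₂₂]
  · simp [pb_eq_covectorBracket hu₁₁ hu₂₁, covectorBracket_comb, h₁₁, h₁₂, h₂₁, h₂₂]
  · simp [pb_eq_covectorBracket hu₁₁ hu₂₂, covectorBracket_comb, h₁₁, h₁₂, h₂₁, h₂₂]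
  · simp [pb_eq_covectorBracket hu₁₂ hu₂₁, covectorBracket_comb, h₁₁, h₁₂, h₂₁, h₂₂]
  · simp [pb_eq_covectorBracket hu₁₂ hu₂₂, covectorBracket_comb, h₁₁, h₁₂, h₂₁, h₂₂]
  · simp [pb_eq_covectorBracket hI₁ hu₂₁, covectorBracket_comb, h₁₁, h₁₂, h₂₁, h₂₂]
  · simp [pb_eq_covectorBracket hI₁ hu₂₂, covectorBracket_comb, h₁₁, h₁₂, h₂₁, h₂₂]
  · rw [pb_eq_covectorBracket hI₂ hu₁₁, covectorBracket_swap]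
    simp [covectorBracket_comb, h₁₁, h₁₂, h₂₁, h₂₂]
  · rw [pb_eq_covectorBracket hI₂ hu₁₂, covectorBracket_swap]
    simp [covectorBracket_comb, h₁₁, h₁₂, h₂₁, h₂₂]
  · rw [pb_eq_covectorBracket hu₁₁ hI₁, covectorBracket_comb, hCC, hCC', covectorBracket_self,
      covectorBracket_self]
    simp only [perp, unit₁, Prod.smul_snd, smul_eq_mul]
    field_simp
    linear_combination (cen aE x).2 * hsc
  · rw [pb_eq_covectorBracket hu₁₂ hI₁, covectorBracket_comb, hCC, hCC', covectorBracket_self,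
      covectorBracket_self]
    simp only [perp, unit₁, Prod.smul_fst, smul_eq_mul]
    field_simp
    linear_combination -(cen aE x).1 * hsc
  · rw [pb_eq_covectorBracket hu₂₁ hI₂, covectorBracket_comb, hVV, hVV', covectorBracket_self,
      covectorBracket_self]
    simp only [perp, unit₂, Prod.smul_snd, smul_eq_mul]
    field_simp
    linear_combination -(vel aE x).1 * hsv
  · rw [pb_eq_covectorBracket hu₂₂ hI₂, covectorBracket_comb, hVV, hVV', covectorBracket_self,
      covectorBracket_self]
    simp only [perp, unit₂, Prod.smul_fst, smul_eq_mul]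
    field_simp
    linear_combination -(vel aE x).2 * hsv
end
end

section
/- Let f > 0 and consider the averaged equations of motion for the potential-free case: ψ̇₁(s) = 0, ψ̇₂(s) = 1, J̇₁(s) = f·χ(J₁(s) > J₂(s)), J̇₂(s) = −f·χ(J₁(s) < J₂(s)), with initial conditions J(0) = (J₁⁰, J₂⁰), ψ(0) = (ψ₁⁰, ψ₂⁰). Set ΔJ := J₂⁰ − J₁⁰ and m := min{J₁⁰, J₂⁰}. Then the continuous curve defined by J₁(s) = m + (f·s − ΔJ)·χ(f·s > ΔJ), J₂(s) = m − (f·s − ΔJ)·χ(f·s < ΔJ), ψ₁(s) = ψ₁⁰, ψ₂(s) = ψ₂⁰ + s satisfies the initial conditions and solves the averaged equations at every s with f·s ≠ ΔJ. -/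
open Real

noncomputable section

/-- explicit solution of the averaged equations in the potential-free case.
With `ΔJ = J₂⁰ − J₁⁰`, `m = min{J₁⁰,J₂⁰}`, the continuous curve
`J₁(s) = m + (fs − ΔJ)χ(fs > ΔJ)`, `J₂(s) = m − (fs − ΔJ)χ(fs < ΔJ)`,
`ψ₁(s) = ψ₁⁰`, `ψ₂(s) = ψ₂⁰ + s` satisfies the initial conditions and solves
`ψ̇₁ = 0`, `ψ̇₂ = 1`, `J̇₁ = f·χ(J₁ > J₂)`, `J̇₂ = −f·χ(J₁ < J₂)` at every `s` with
`f·s ≠ ΔJ`. -/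
theorem averaged_solution_potential_free
    (f : ℝ) (hf : 0 < f) (J₁0 J₂0 ψ₁0 ψ₂0 : ℝ)
    (ΔJ m : ℝ) (hΔJ : ΔJ = J₂0 - J₁0) (hm : m = min J₁0 J₂0)
    (J₁ J₂ ψ₁ ψ₂ : ℝ → ℝ)
    (hJ₁ : ∀ s, J₁ s = m + (f * s - ΔJ) * (if f * s > ΔJ then 1 else 0))
    (hJ₂ : ∀ s, J₂ s = m - (f * s - ΔJ) * (if f * s < ΔJ then 1 else 0))
    (hψ₁ : ∀ s, ψ₁ s = ψ₁0) (hψ₂ : ∀ s, ψ₂ s = ψ₂0 + s) :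
    Continuous J₁ ∧ Continuous J₂ ∧
    J₁ 0 = J₁0 ∧ J₂ 0 = J₂0 ∧ ψ₁ 0 = ψ₁0 ∧ ψ₂ 0 = ψ₂0 ∧
    ∀ s : ℝ, f * s ≠ ΔJ →
      HasDerivAt ψ₁ 0 s ∧
      HasDerivAt ψ₂ 1 s ∧
      HasDerivAt J₁ (f * (if J₁ s > J₂ s then 1 else 0)) s ∧
      HasDerivAt J₂ (-(f * (if J₁ s < J₂ s then 1 else 0))) s := by
  have hJ₁_max : J₁ = fun s => m + max (f * s - ΔJ) 0 := by
    funext s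
    rw [hJ₁ s]
    split_ifs with h
    · rw [max_eq_left (by linarith), mul_one]
    · rw [max_eq_right (by linarith), mul_zero]
  have hJ₂_max : J₂ = fun s => m + max (ΔJ - f * s) 0 := by
    funext s
    rw [hJ₂ s]
    split_ifs with h
    · rw [max_eq_left (by linarith)]
      ring
    · rw [max_eq_right (by linarith)]
      ring
  have hlin (s : ℝ) : HasDerivAt (fun t => f * t) f s := by
    simpa using (hasDerivAt_id s).const_mul f
  have hcont : Continuous fun t : ℝ => f * t := by fun_prop
  refine ⟨by rw [hJ₁_max]; fun_prop, by rw [hJ₂_max]; fun_prop, ?_, ?_, hψ₁ 0,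
    by rw [hψ₂, add_zero], ?_⟩
  · rw [hJ₁_max]
    rcases le_total J₁0 J₂0 with h | h
    · simp [hm, hΔJ, h]
    · simp [hm, hΔJ, h]
  · rw [hJ₂_max]
    rcases le_total J₁0 J₂0 with h | h
    · simp [hm, hΔJ, h]
    · simp [hm, hΔJ, h]
  intro s hs
  refine ⟨?_, ?_, ?_⟩
  · rw [funext hψ₁]
    exact hasDerivAt_const s ψ₁0
  · rw [funext hψ₂]
    exact (hasDerivAt_id s).const_add ψ₂0
  rcases lt_or_gt_of_ne hs with h | h
  · have hlt : J₁ s < J₂ s := by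
      rw [hJ₁ s, hJ₂ s, if_neg h.not_gt, if_pos h]
      linarith
    have hev := hcont.continuousAt.eventually_lt_const h
    rw [if_neg hlt.not_gt, if_pos hlt, mul_zero, mul_one]
    constructor
    · refine (hasDerivAt_const s m).congr_of_eventuallyEq ?_
      filter_upwards [hev] with t ht
      rw [hJ₁ t, if_neg ht.not_gt, mul_zero, add_zero]
    · refine (((hlin s).sub_const ΔJ).const_sub m).congr_of_eventuallyEq ?_
      filter_upwards [hev] with t ht
      rw [hJ₂ t, if_pos ht, mul_one]
  · have hgt : J₂ s < J₁ s := by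
      rw [hJ₁ s, hJ₂ s, if_pos h, if_neg h.not_gt]
      linarith
    have hev := hcont.continuousAt.eventually_const_lt h
    rw [if_pos hgt, if_neg hgt.not_gt, mul_zero, mul_one, neg_zero]
    constructor
    · refine (((hlin s).sub_const ΔJ).const_add m).congr_of_eventuallyEq ?_
      filter_upwards [hev] with t ht
      rw [hJ₁ t, if_pos ht, mul_one]
    · refine (hasDerivAt_const s m).congr_of_eventuallyEq ?_
      filter_upwards [hev] with t ht
      rw [hJ₂ t, if_neg ht.not_gt, mul_zero, sub_zero]
end
end

section
/- Let E : ℝ²∖{0} → ℝ² be of the form E(q) = f·q^⊥/|q|² + W(q) with f > 0 and W continuous satisfying q ∧ W(q) = 0 for all q (zero torque). Let q : (α,β) → ℝ²∖{0} be a C² solution of q̈(s) = −q̇(s)^⊥ + E(q(s)), and set I₁(s) := |c(s)|²/2, I₂(s) := |v(s)|²/2 where v(s) := q̇(s), c(s) := q(s) − v(s)^⊥. Then I₁(s) − I₂(s) = f·(s − s₀) for all s ∈ (α,β), where s₀ (the hitting time) is the unique real number determined by this equation, namely s₀ = −(I₁(0) − I₂(0))/f when 0 ∈ (α,β). -/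
open Set

noncomputable section

/-- `w ∧ z = w₁z₂ − w₂z₁`. -/
def wedge (w z : ℝ × ℝ) : ℝ := w.1 * z.2 - w.2 * z.1

/-- The difference of the center action and the energy, in terms of position and velocity. -/
lemma center_action_sub_energy (q v : ℝ × ℝ) :
    ((q - perp v).1 ^ 2 + (q - perp v).2 ^ 2) / 2 - (v.1 ^ 2 + v.2 ^ 2) / 2 =
      (q.1 ^ 2 + q.2 ^ 2) / 2 + wedge q v := by
  simp only [perp, wedge, Prod.fst_sub, Prod.snd_sub]
  ring

/-- The torque of the field `f·q^⊥/|q|²` is `f`. -/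
lemma wedge_smul_perp_add {q w : ℝ × ℝ} (f : ℝ) (hq : q ≠ 0) (hw : wedge q w = 0) :
    wedge q ((f / (q.1 ^ 2 + q.2 ^ 2)) • perp q + w) = f := by
  have hne : q.1 ^ 2 + q.2 ^ 2 ≠ 0 := by
    intro h
    exact hq (Prod.ext (by simp only [Prod.fst_zero]; nlinarith [sq_nonneg q.1, sq_nonneg q.2])
      (by simp only [Prod.snd_zero]; nlinarith [sq_nonneg q.1, sq_nonneg q.2]))
  simp only [perp, wedge, Prod.fst_add, Prod.snd_add, Prod.smul_fst, Prod.smul_snd,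
    smul_eq_mul] at hw ⊢
  have h : f / (q.1 ^ 2 + q.2 ^ 2) * (q.1 ^ 2 + q.2 ^ 2) = f := div_mul_cancel₀ f hne
  linear_combination h + hw

/-- Along a solution of `q̈ = −q̇^⊥ + F`, the torque of `F` is the rate of change of
`|q|²/2 + q ∧ q̇`. -/
lemma hasDerivAt_half_normSq_add_wedge {q v : ℝ → ℝ × ℝ} {F : ℝ × ℝ} {s : ℝ}
    (hq : HasDerivAt q (v s) s) (hv : HasDerivAt v (-perp (v s) + F) s) :
    HasDerivAt (fun t => ((q t).1 ^ 2 + (q t).2 ^ 2) / 2 + wedge (q t) (v t))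
      (wedge (q s) F) s := by
  have h₁ : HasDerivAt (fun t => (q t).1) (v s).1 s := hq.fst
  have h₂ : HasDerivAt (fun t => (q t).2) (v s).2 s := hq.snd
  have k₁ : HasDerivAt (fun t => (v t).1) (-perp (v s) + F).1 s := hv.fst
  have k₂ : HasDerivAt (fun t => (v t).2) (-perp (v s) + F).2 s := hv.snd
  have h := (((h₁.fun_pow 2).fun_add (h₂.fun_pow 2)).div_const 2).fun_add
    ((h₁.fun_mul k₂).fun_sub (h₂.fun_mul k₁))
  refine h.congr_deriv ?_
  simp only [perp, wedge, Prod.fst_add, Prod.snd_add, Prod.fst_neg, Prod.snd_neg]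
  push_cast
  ring

/-- zero-torque case.  For `E(q) = f·q^⊥/|q|² + W(q)` with `q ∧ W(q) = 0`,
along any C² solution of `q̈ = −q̇^⊥ + E(q)` with values in `ℝ²∖{0}` (defined on an
interval `(α,β) ∋ 0`) one has `I₁(s) − I₂(s) = f·(s − s₀)` with the hitting time
`s₀ = −(I₁(0) − I₂(0))/f`, and `s₀` is the unique real number with this property. -/
theorem hitting_time_identity
    (f : ℝ) (hf : 0 < f)
    (W : ℝ × ℝ → ℝ × ℝ) (hW : ContinuousOn W {q : ℝ × ℝ | q ≠ 0})
    (htorque : ∀ q : ℝ × ℝ, q ≠ 0 → wedge q (W q) = 0)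
    (E : ℝ × ℝ → ℝ × ℝ)
    (hE : ∀ q : ℝ × ℝ, q ≠ 0 → E q = (f / (q.1 ^ 2 + q.2 ^ 2)) • perp q + W q)
    (α β : ℝ) (q q' : ℝ → ℝ × ℝ)
    (hq0 : ∀ s ∈ Ioo α β, q s ≠ 0)
    (hq : ∀ s ∈ Ioo α β, HasDerivAt q (q' s) s)
    (hNewton : ∀ s ∈ Ioo α β, HasDerivAt q' (-perp (q' s) + E (q s)) s)
    (I₁ I₂ : ℝ → ℝ)
    (hI₁ : ∀ s, I₁ s = ((q s - perp (q' s)).1 ^ 2 + (q s - perp (q' s)).2 ^ 2) / 2)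
    (hI₂ : ∀ s, I₂ s = ((q' s).1 ^ 2 + (q' s).2 ^ 2) / 2)
    (h0 : (0 : ℝ) ∈ Ioo α β) :
    (∀ s ∈ Ioo α β, I₁ s - I₂ s = f * (s - (-(I₁ 0 - I₂ 0) / f))) ∧
    (∃! s₀ : ℝ, ∀ s ∈ Ioo α β, I₁ s - I₂ s = f * (s - s₀)) := by
  have hder : ∀ s ∈ Ioo α β, HasDerivAt (fun t => I₁ t - I₂ t) f s := by
    intro s hs
    have h := hasDerivAt_half_normSq_add_wedge (hq s hs) (hNewton s hs)
    rw [hE _ (hq0 s hs), wedge_smul_perp_add f (hq0 s hs) (htorque _ (hq0 s hs))] at h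
    simpa only [hI₁, hI₂, center_action_sub_energy] using h
  have hlin : ∀ s ∈ Ioo α β, HasDerivAt (fun t => I₁ 0 - I₂ 0 + f * t) f s := fun s _ => by
    simpa using ((hasDerivAt_id s).const_mul f).const_add (I₁ 0 - I₂ 0)
  have heq : EqOn (fun t => I₁ t - I₂ t) (fun t => I₁ 0 - I₂ 0 + f * t) (Ioo α β) :=
    isOpen_Ioo.eqOn_of_deriv_eq isPreconnected_Ioo
      (fun s hs => (hder s hs).differentiableAt.differentiableWithinAt)
      (fun s hs => (hlin s hs).differentiableAt.differentiableWithinAt)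
      (fun s hs => (hder s hs).deriv.trans (hlin s hs).deriv.symm) h0 (by simp)
  have hmain : ∀ s ∈ Ioo α β, I₁ s - I₂ s = f * (s - (-(I₁ 0 - I₂ 0) / f)) := by
    intro s hs
    have h : I₁ s - I₂ s = I₁ 0 - I₂ 0 + f * s := heq hs
    rw [h]
    field_simp
    ring
  refine ⟨hmain, _, hmain, fun s₁ h₁ => ?_⟩
  have h := mul_left_cancel₀ hf.ne' ((h₁ 0 h0).symm.trans (hmain 0 h0))
  linarith
end
end

section
/- Let f > 0 and let q : (α,β) → ℝ²∖{0} be a C² solution of q̈(s) = −q̇(s)^⊥ + f·q(s)^⊥/|q(s)|². Let θ : (α,β) → ℝ be any continuous argument function of q, i.e. q(s) = |q(s)|·(cos θ(s), sin θ(s)) for all s. Then the quantity K(s) := |q̇(s)|²/2 − f·θ(s) is constant on (α,β). (In action-angle variables this says K = I₂ − f·arg(q) is an integral of motion of the full flow in the potential-free case.) -/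
open Set

noncomputable section

/-- A continuous argument function `θ` of a differentiable nonvanishing plane curve `q` is
differentiable, with derivative `(q₁ v₂ - q₂ v₁) / |q|²`, where `v` is the velocity of `q`. -/
theorem HasDerivAt.continuous_argument {q : ℝ → ℝ × ℝ} {v : ℝ × ℝ} {θ : ℝ → ℝ} {s : ℝ}
    (hq : HasDerivAt q v s) (hq0 : ∀ᶠ t in nhds s, q t ≠ 0) (hθc : ContinuousAt θ s)
    (hθ : ∀ᶠ t in nhds s,
      q t = Real.sqrt ((q t).1 ^ 2 + (q t).2 ^ 2) • (Real.cos (θ t), Real.sin (θ t))) :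
    HasDerivAt θ (((q s).1 * v.2 - (q s).2 * v.1) / ((q s).1 ^ 2 + (q s).2 ^ 2)) s := by
  have polar : ∀ᶠ t in nhds s, ∃ r : ℝ, 0 < r ∧ (q t).1 = r * Real.cos (θ t) ∧
      (q t).2 = r * Real.sin (θ t) := by
    filter_upwards [hq0, hθ] with t h0 ht
    refine ⟨_, Real.sqrt_pos.2 ?_, congrArg Prod.fst ht, congrArg Prod.snd ht⟩
    by_contra! h
    exact h0 (Prod.ext (by
      simp only [Prod.fst_zero]; nlinarith [sq_nonneg (q t).1, sq_nonneg (q t).2])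
      (by simp only [Prod.snd_zero]; nlinarith [sq_nonneg (q t).1, sq_nonneg (q t).2]))
  obtain ⟨r, hr, h1, h2⟩ := polar.self_of_nhds
  have hsc := Real.sin_sq_add_cos_sq (θ s)
  have hq1 : HasDerivAt (fun t => (q t).1) v.1 s := hq.fst
  have hq2 : HasDerivAt (fun t => (q t).2) v.2 s := hq.snd
  have hN := (hq2.mul_const (Real.cos (θ s))).sub (hq1.mul_const (Real.sin (θ s)))
  have hD := (hq1.mul_const (Real.cos (θ s))).add (hq2.mul_const (Real.sin (θ s)))
  have hN0 : (q s).2 * Real.cos (θ s) - (q s).1 * Real.sin (θ s) = 0 := by rw [h1, h2]; ring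
  have hD0 : (q s).1 * Real.cos (θ s) + (q s).2 * Real.sin (θ s) = r := by
    rw [h1, h2]; linear_combination r * hsc
  have hr2 : (q s).1 ^ 2 + (q s).2 ^ 2 = r ^ 2 := by
    rw [h1, h2]; linear_combination r ^ 2 * hsc
  have hA := ((hN.div hD (by simpa [hD0] using hr.ne')).arctan).const_add (θ s)
  refine (hA.congr_of_eventuallyEq ?_).congr_deriv ?_
  · have hnear : ∀ᶠ t in nhds s, |θ t - θ s| < Real.pi / 2 := by
      simpa [Real.dist_eq] using Metric.tendsto_nhds.1 hθc (Real.pi / 2) (by positivity)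
    filter_upwards [polar, hnear] with t ⟨ρ, hρ, e1, e2⟩ ht
    obtain ⟨hl, hu⟩ := abs_lt.1 ht
    have key : ((q t).2 * Real.cos (θ s) - (q t).1 * Real.sin (θ s)) /
        ((q t).1 * Real.cos (θ s) + (q t).2 * Real.sin (θ s)) = Real.tan (θ t - θ s) := by
      rw [Real.tan_eq_sin_div_cos, ← mul_div_mul_left (Real.sin _) _ hρ.ne',
        Real.sin_sub, Real.cos_sub, e1, e2]
      congr 1 <;> ring
    simp only [Pi.div_apply, Pi.sub_apply, Pi.add_apply, key, Real.arctan_tan hl hu]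
    ring
  · simp only [Pi.div_apply, Pi.sub_apply, Pi.add_apply, hN0, hD0, hr2]
    rw [h1, h2]
    field_simp
    ring

/-- the quantity `K = I₂ − f·arg(q) = |q̇|²/2 − f·θ` is an integral of motion
of the full flow in the potential-free case `q̈ = −q̇^⊥ + f·q^⊥/|q|²`, for any continuous
argument function `θ` of the solution `q`. -/
theorem K_is_integral_of_motion
    (f : ℝ) (hf : 0 < f)
    (α β : ℝ) (q q' : ℝ → ℝ × ℝ)
    (hq0 : ∀ s ∈ Ioo α β, q s ≠ 0)
    (hq : ∀ s ∈ Ioo α β, HasDerivAt q (q' s) s)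
    (hNewton : ∀ s ∈ Ioo α β, HasDerivAt q'
      (-perp (q' s) + (f / ((q s).1 ^ 2 + (q s).2 ^ 2)) • perp (q s)) s)
    (θ : ℝ → ℝ) (hθc : ContinuousOn θ (Ioo α β))
    (hθ : ∀ s ∈ Ioo α β,
      q s = Real.sqrt ((q s).1 ^ 2 + (q s).2 ^ 2) • (Real.cos (θ s), Real.sin (θ s))) :
    ∀ s₁ ∈ Ioo α β, ∀ s₂ ∈ Ioo α β,
      ((q' s₁).1 ^ 2 + (q' s₁).2 ^ 2) / 2 - f * θ s₁ =
        ((q' s₂).1 ^ 2 + (q' s₂).2 ^ 2) / 2 - f * θ s₂ := by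
  have hK : ∀ s ∈ Ioo α β, HasDerivAt
      (fun s => ((q' s).1 ^ 2 + (q' s).2 ^ 2) / 2 - f * θ s) 0 s := by
    intro s hs
    have hnhds : Ioo α β ∈ nhds s := isOpen_Ioo.mem_nhds hs
    have hθ' := (hq s hs).continuous_argument (Filter.eventually_of_mem hnhds hq0)
      (hθc.continuousAt hnhds) (Filter.eventually_of_mem hnhds hθ)
    have h1 : HasDerivAt (fun t => (q' t).1) _ s := (hNewton s hs).fst
    have h2 : HasDerivAt (fun t => (q' t).2) _ s := (hNewton s hs).snd
    refine ((((h1.pow 2).add (h2.pow 2)).div_const 2).sub (hθ'.const_mul f)).congr_deriv ?_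
    simp only [perp, Prod.fst_add, Prod.snd_add, Prod.fst_neg, Prod.snd_neg, Prod.smul_fst,
      Prod.smul_snd, smul_eq_mul]
    ring
  intro s₁ h₁ s₂ h₂
  exact isOpen_Ioo.is_const_of_deriv_eq_zero isPreconnected_Ioo
    (fun s hs => (hK s hs).differentiableAt.differentiableWithinAt)
    (fun s hs => (hK s hs).deriv) h₁ h₂
end
end

section
/- Let f > 0 and let q : [s*, ∞) → ℝ²∖{0} be a C² solution of q̈(s) = −q̇(s)^⊥ + f·q(s)^⊥/|q(s)|². Then the limit u := lim_{s→∞} q(s)/√s exists in ℝ² and |u| = √(2f): in the far future the particle drifts diffusively away from the flux line, its position growing like a fixed vector times √s. (In the original physical units this reads q(t)/√t → √(Φ₀/(2πB))·e(a₀²/(4f²) − K/f) as t → ∞.) -/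
open Set Filter Topology

noncomputable section

/-- A function whose derivative is dominated by that of a function vanishing at infinity
converges. -/
theorem exists_tendsto_of_abs_deriv_le {F N F' N' : ℝ → ℝ} {a : ℝ}
    (hF : ∀ s, a < s → HasDerivAt F (F' s) s) (hN : ∀ s, a < s → HasDerivAt N (N' s) s)
    (hle : ∀ s, a < s → |F' s| ≤ -N' s) (hN0 : Tendsto N atTop (𝓝 0)) :
    ∃ l, Tendsto F atTop (𝓝 l) := by
  have hanti : AntitoneOn (fun s => F s + N s) (Ioi a) := by
    refine antitoneOn_of_hasDerivWithinAt_nonpos (convex_Ioi a)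
      (fun s hs => ((hF s hs).add (hN s hs)).continuousAt.continuousWithinAt)
      (fun s hs => ((hF s ?_).add (hN s ?_)).hasDerivWithinAt) ?_
    · simpa using hs
    · simpa using hs
    · intro s hs
      have := abs_le.1 (hle s (by simpa using hs))
      linarith [this.2]
  have hmono : MonotoneOn (fun s => F s - N s) (Ioi a) := by
    refine monotoneOn_of_hasDerivWithinAt_nonneg (convex_Ioi a)
      (fun s hs => ((hF s hs).sub (hN s hs)).continuousAt.continuousWithinAt)
      (fun s hs => ((hF s ?_).sub (hN s ?_)).hasDerivWithinAt) ?_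
    · simpa using hs
    · simpa using hs
    · intro s hs
      have := abs_le.1 (hle s (by simpa using hs))
      linarith [this.1]
  have hNanti : AntitoneOn N (Ioi a) := by
    refine antitoneOn_of_hasDerivWithinAt_nonpos (convex_Ioi a)
      (fun s hs => (hN s hs).continuousAt.continuousWithinAt)
      (fun s hs => (hN s ?_).hasDerivWithinAt) ?_
    · simpa using hs
    · intro s hs
      linarith [abs_nonneg (F' s), hle s (by simpa using hs)]
  have hNnonneg : ∀ s, a < s → 0 ≤ N s := fun s hs => by
    refine le_of_tendsto hN0 ?_
    filter_upwards [eventually_ge_atTop s] with t ht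
    exact hNanti hs (lt_of_lt_of_le hs ht) ht
  set G : ℝ → ℝ := fun s => F (max s (a + 1)) - N (max s (a + 1)) with hG
  have hmem : ∀ s, a < max s (a + 1) := fun s => lt_of_lt_of_le (by linarith) (le_max_right _ _)
  have hGmono : Monotone G := fun s t hst =>
    hmono (hmem s) (hmem t) (max_le_max_right _ hst)
  have hGbdd : BddAbove (range G) := by
    refine ⟨F (a + 1) + N (a + 1), ?_⟩
    rintro _ ⟨s, rfl⟩
    have h1 := hanti (show a + 1 ∈ Ioi a by simp) (hmem s) (le_max_right _ _)
    have h2 := hNnonneg _ (hmem s)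
    simp only [hG] at h1 ⊢
    linarith
  refine ⟨_, ((tendsto_atTop_ciSup hGmono hGbdd).add hN0).congr' ?_⟩
  filter_upwards [eventually_ge_atTop (a + 1)] with s hs
  simp [hG, max_eq_left hs]

/-- The corrected angle `E / f - arctan (ρ' / (ρ + T))` of the guiding centre has derivative
`f ρ' / (4 ρ (T + E))`. -/
theorem hasDerivAt_guidingAngle {f s : ℝ} {ρ g E T : ℝ → ℝ} (hf : 0 < f)
    (hρ : 0 < ρ s) (hT : 0 < T s) (hE : 0 ≤ E s)
    (hid : 4 * ρ s * E s = g s ^ 2 + (T s - ρ s) ^ 2)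
    (hdρ : HasDerivAt ρ (g s) s) (hdg : HasDerivAt g (2 * E s + T s - ρ s) s)
    (hdE : HasDerivAt E (f * (T s - ρ s) / (2 * ρ s)) s) (hdT : HasDerivAt T f s) :
    HasDerivAt (fun t => E t / f - Real.arctan (g t / (ρ t + T t)))
      (f * g s / (4 * ρ s * (T s + E s))) s := by
  have hne : ρ s + T s ≠ 0 := by positivity
  have hM : T s + E s ≠ 0 := by positivity
  have hden : 0 < (ρ s + T s) ^ 2 + g s ^ 2 := by positivity
  have h := (hdE.div_const f).sub ((hdg.div (hdρ.add hdT) hne).arctan)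
  refine h.congr_deriv ?_
  have e : 1 + (g s / (ρ s + T s)) ^ 2 = 4 * ρ s * (T s + E s) / (ρ s + T s) ^ 2 := by
    field_simp
    linarith
  simp only [Pi.add_apply, Pi.div_apply]
  rw [e]
  field_simp
  linear_combination (-2) * hid

/-- The guiding angle after removing the oscillating first-order terms. -/
def reducedAngle (f : ℝ) (ρ g E T : ℝ → ℝ) (t : ℝ) : ℝ :=
  E t / f - Real.arctan (g t / (ρ t + T t)) + f / 4 * (T t + E t)⁻¹
    - f / 4 * (Real.log (ρ t / (T t + E t)) * (T t + E t)⁻¹)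

theorem hasDerivAt_add_inv {f s : ℝ} {ρ E T : ℝ → ℝ}
    (hρ : 0 < ρ s) (hT : 0 < T s) (hE : 0 ≤ E s)
    (hdE : HasDerivAt E (f * (T s - ρ s) / (2 * ρ s)) s) (hdT : HasDerivAt T f s) :
    HasDerivAt (fun t => (T t + E t)⁻¹)
      (-(f * (ρ s + T s) / (2 * ρ s) / (T s + E s) ^ 2)) s := by
  have hM : T s + E s ≠ 0 := by positivity
  refine ((hdT.add hdE).inv hM).congr_deriv ?_
  simp only [Pi.add_apply]
  field_simp
  ring

theorem hasDerivAt_reducedAngle {f s : ℝ} {ρ g E T : ℝ → ℝ} (hf : 0 < f)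
    (hρ : 0 < ρ s) (hT : 0 < T s) (hE : 0 ≤ E s)
    (hid : 4 * ρ s * E s = g s ^ 2 + (T s - ρ s) ^ 2)
    (hdρ : HasDerivAt ρ (g s) s) (hdg : HasDerivAt g (2 * E s + T s - ρ s) s)
    (hdE : HasDerivAt E (f * (T s - ρ s) / (2 * ρ s)) s) (hdT : HasDerivAt T f s) :
    HasDerivAt (reducedAngle f ρ g E T)
      (f / 4 * Real.log (ρ s / (T s + E s)) *
        (f * (ρ s + T s) / (2 * ρ s) / (T s + E s) ^ 2)) s := by
  have hM : 0 < T s + E s := by positivity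
  have hinv := hasDerivAt_add_inv hρ hT hE hdE hdT
  have hlog := (hdρ.div (hdT.add hdE) hM.ne').log (by simp; exact ⟨hρ.ne', hM.ne'⟩)
  have h := ((hasDerivAt_guidingAngle hf hρ hT hE hid hdρ hdg hdE hdT).add
    (hinv.const_mul (f / 4))).sub ((hlog.mul hinv).const_mul (f / 4))
  refine h.congr_deriv ?_
  simp only [Pi.add_apply, Pi.div_apply]
  field_simp
  ring

/-- Boundedness of the energy: the adiabatic invariant does not grow. -/
theorem exists_energy_bound {f a : ℝ} {ρ g E T : ℝ → ℝ} (hf : 0 < f)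
    (hρ : ∀ s, a < s → 0 < ρ s) (hT : ∀ s, a < s → 0 < T s) (hE : ∀ s, a < s → 0 ≤ E s)
    (hid : ∀ s, a < s → 4 * ρ s * E s = g s ^ 2 + (T s - ρ s) ^ 2)
    (hdρ : ∀ s, a < s → HasDerivAt ρ (g s) s)
    (hdg : ∀ s, a < s → HasDerivAt g (2 * E s + T s - ρ s) s)
    (hdE : ∀ s, a < s → HasDerivAt E (f * (T s - ρ s) / (2 * ρ s)) s)
    (hdT : ∀ s, a < s → HasDerivAt T f s) :
    ∃ K, ∀ s, a + 1 ≤ s → E s ≤ K := by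
  have hlog : ∀ s, a < s → Real.log (ρ s / (T s + E s)) ≤ Real.log 4 := by
    intro s hs
    have h1 := hρ s hs
    have h2 := hT s hs
    have h3 := hE s hs
    have hM : 0 < T s + E s := by positivity
    refine Real.log_le_log (by positivity) ?_
    rw [div_le_iff₀ hM]
    nlinarith [hid s hs, sq_nonneg (g s), sq_nonneg (ρ s - 4 * (T s + E s))]
  set k := f / 4 * Real.log 4
  have hanti : AntitoneOn (fun s => reducedAngle f ρ g E T s + k * (T s + E s)⁻¹) (Ioi a) := by
    have hd : ∀ s, a < s → _ := fun s hs =>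
      (hasDerivAt_reducedAngle hf (hρ s hs) (hT s hs) (hE s hs) (hid s hs) (hdρ s hs) (hdg s hs)
        (hdE s hs) (hdT s hs)).add ((hasDerivAt_add_inv (hρ s hs) (hT s hs) (hE s hs)
        (hdE s hs) (hdT s hs)).const_mul k)
    refine antitoneOn_of_hasDerivWithinAt_nonpos (convex_Ioi a)
      (fun s hs => (hd s hs).continuousAt.continuousWithinAt)
      (fun s hs => (hd s (by simpa using hs)).hasDerivWithinAt) ?_
    intro s hs
    rw [interior_Ioi] at hs
    have h1 := hρ s hs
    have h2 := hT s hs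
    have h3 := hE s hs
    have hp : 0 ≤ f / 4 * (f * (ρ s + T s) / (2 * ρ s) / (T s + E s) ^ 2) := by positivity
    have := mul_le_mul_of_nonneg_left (hlog s hs) hp
    simp only [k]
    linarith
  refine ⟨f * (reducedAngle f ρ g E T (a + 1) + k * (T (a + 1) + E (a + 1))⁻¹ + Real.pi / 2), ?_⟩
  intro s hs
  have has : a < s := by linarith
  have h := hanti (show a + 1 ∈ Ioi a by simp) has hs
  have h2 := hT s has
  have h3 := hE s has
  have hM : 0 < (T s + E s)⁻¹ := by positivity
  have hl := mul_le_mul_of_nonneg_right (hlog s has) hM.le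
  have hψ := (Real.arctan_lt_pi_div_two (g s / (ρ s + T s))).le
  simp only [reducedAngle, k] at h ⊢
  rw [← div_le_iff₀' hf]
  nlinarith [mul_pos hf hM, mul_le_mul_of_nonneg_left hl hf.le]

/-- Convergence of the guiding angle. -/
theorem exists_tendsto_guidingAngle {f a : ℝ} {ρ g E T : ℝ → ℝ} {K : ℝ} (hf : 0 < f)
    (hρ : ∀ s, a < s → 0 < ρ s) (hT : ∀ s, a < s → 0 < T s) (hE : ∀ s, a < s → 0 ≤ E s)
    (hid : ∀ s, a < s → 4 * ρ s * E s = g s ^ 2 + (T s - ρ s) ^ 2)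
    (hdρ : ∀ s, a < s → HasDerivAt ρ (g s) s)
    (hdg : ∀ s, a < s → HasDerivAt g (2 * E s + T s - ρ s) s)
    (hdE : ∀ s, a < s → HasDerivAt E (f * (T s - ρ s) / (2 * ρ s)) s)
    (hdT : ∀ s, a < s → HasDerivAt T f s)
    (hK : ∀ s, a < s → E s ≤ K) (hTK : ∀ s, a < s → K ≤ T s) (hTtop : Tendsto T atTop atTop) :
    ∃ l, Tendsto (fun t => E t / f - Real.arctan (g t / (ρ t + T t))) atTop (𝓝 l) := by
  have hM : ∀ s, a < s → 0 < T s + E s := fun s hs => by linarith [hT s hs, hE s hs]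
  have hlog : ∀ s, a < s → |Real.log (ρ s / (T s + E s))| ≤ Real.log 16 := by
    intro s hs
    have h1 := hρ s hs
    have h2 := hT s hs
    have h3 := hE s hs
    have h4 := hid s hs
    have h5 : E s ≤ T s := (hK s hs).trans (hTK s hs)
    have hM := hM s hs
    rw [abs_le, ← Real.log_inv]
    constructor
    · refine Real.log_le_log (by norm_num) ?_
      rw [le_div_iff₀ hM]
      by_contra! hlt
      nlinarith [sq_nonneg (g s), mul_le_mul_of_nonneg_left h5 h1.le]
    · refine Real.log_le_log (by positivity) ?_
      rw [div_le_iff₀ hM]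
      nlinarith [sq_nonneg (g s), sq_nonneg (ρ s - 4 * (T s + E s))]
  have hinv : Tendsto (fun s => (T s + E s)⁻¹) atTop (𝓝 0) := by
    refine (tendsto_atTop_mono' _ ?_ hTtop).inv_tendsto_atTop
    filter_upwards [eventually_gt_atTop a] with s hs
    linarith [hE s hs]
  set k := f / 4 * Real.log 16
  obtain ⟨l, hl⟩ := exists_tendsto_of_abs_deriv_le
    (fun s hs => hasDerivAt_reducedAngle hf (hρ s hs) (hT s hs) (hE s hs) (hid s hs) (hdρ s hs)
      (hdg s hs) (hdE s hs) (hdT s hs))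
    (fun s hs => (hasDerivAt_add_inv (hρ s hs) (hT s hs) (hE s hs) (hdE s hs)
      (hdT s hs)).const_mul k)
    (fun s hs => by
      have h1 := hρ s hs
      have h2 := hT s hs
      have h3 := hE s hs
      have hp : 0 ≤ f / 4 * (f * (ρ s + T s) / (2 * ρ s) / (T s + E s) ^ 2) := by positivity
      have h5 := mul_le_mul_of_nonneg_left (hlog s hs) hp
      have h6 : 0 ≤ f * (ρ s + T s) / (2 * ρ s) / (T s + E s) ^ 2 := by positivity
      rw [abs_mul, abs_mul, abs_of_nonneg h6, abs_of_nonneg (show 0 ≤ f / 4 by positivity)]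
      simp only [k]
      linarith)
    (by simpa using hinv.const_mul k)
  have hlogM : Tendsto (fun s => Real.log (ρ s / (T s + E s)) * (T s + E s)⁻¹) atTop (𝓝 0) := by
    refine squeeze_zero_norm' ?_ (by simpa using hinv.const_mul (Real.log 16))
    filter_upwards [eventually_gt_atTop a] with s hs
    have hp := (inv_pos.2 (hM s hs)).le
    rw [norm_mul, Real.norm_eq_abs, Real.norm_of_nonneg hp]
    exact mul_le_mul_of_nonneg_right (hlog s hs) hp
  have h := (hl.sub (hinv.const_mul (f / 4))).add (hlogM.const_mul (f / 4))
  refine ⟨_, h.congr fun s => ?_⟩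
  simp only [reducedAngle]
  ring

/-- A planar curve `C` with `|C|² = 2 M` whose velocity is `M' / (2 M) C + Θ' C^⊥`, with `M / s`
and `Θ` convergent, satisfies that `C / √s` converges. -/
theorem exists_tendsto_div_sqrt_of_polar {f a l : ℝ} {X Y M Θ M' Θ' : ℝ → ℝ}
    (hM : ∀ s, a < s → 0 < M s) (hXY : ∀ s, a < s → X s ^ 2 + Y s ^ 2 = 2 * M s)
    (hdM : ∀ s, a < s → HasDerivAt M (M' s) s) (hdΘ : ∀ s, a < s → HasDerivAt Θ (Θ' s) s)
    (hdX : ∀ s, a < s → HasDerivAt X (M' s / (2 * M s) * X s - Θ' s * Y s) s)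
    (hdY : ∀ s, a < s → HasDerivAt Y (M' s / (2 * M s) * Y s + Θ' s * X s) s)
    (hMf : Tendsto (fun s => M s / s) atTop (𝓝 f)) (hf : 0 < f) (hΘ : Tendsto Θ atTop (𝓝 l)) :
    ∃ u v : ℝ, Tendsto (fun s => (Real.sqrt s)⁻¹ * X s) atTop (𝓝 u) ∧
      Tendsto (fun s => (Real.sqrt s)⁻¹ * Y s) atTop (𝓝 v) ∧ u ^ 2 + v ^ 2 = 2 * f := by
  have hdm : ∀ s, a < s → HasDerivAt (fun t => Real.sqrt (M t)) (M' s / (2 * √(M s))) s :=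
    fun s hs => (hdM s hs).sqrt (hM s hs).ne'
  have hconst : ∀ P : ℝ → ℝ, (∀ s, a < s → HasDerivAt P 0 s) → ∃ c, ∀ s, a < s → P s = c :=
    fun P hP => isOpen_Ioi.exists_is_const_of_deriv_eq_zero isPreconnected_Ioi
      (fun s hs => (hP s hs).differentiableAt.differentiableWithinAt) fun s hs => (hP s hs).deriv
  obtain ⟨p, hp⟩ := hconst
    (fun t => (Real.cos (Θ t) * X t + Real.sin (Θ t) * Y t) / √(M t)) fun s hs => by
      have h0 := Real.sqrt_pos.2 (hM s hs)
      refine ((((hdΘ s hs).cos.mul (hdX s hs)).add ((hdΘ s hs).sin.mul (hdY s hs))).div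
        (hdm s hs) h0.ne').congr_deriv ?_
      have h1 := Real.sq_sqrt (hM s hs).le
      simp only [Pi.add_apply, Pi.mul_apply]
      rw [← h1, Real.sqrt_sq h0.le]
      field_simp
      ring
  obtain ⟨r, hr⟩ := hconst
    (fun t => (Real.cos (Θ t) * Y t - Real.sin (Θ t) * X t) / √(M t)) fun s hs => by
      have h0 := Real.sqrt_pos.2 (hM s hs)
      refine ((((hdΘ s hs).cos.mul (hdY s hs)).sub ((hdΘ s hs).sin.mul (hdX s hs))).div
        (hdm s hs) h0.ne').congr_deriv ?_
      have h1 := Real.sq_sqrt (hM s hs).le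
      simp only [Pi.sub_apply, Pi.mul_apply]
      rw [← h1, Real.sqrt_sq h0.le]
      field_simp
      ring
  have hpr : p ^ 2 + r ^ 2 = 2 := by
    have ha : a < a + 1 := by linarith
    have hM0 := hM _ ha
    rw [← hp _ ha, ← hr _ ha, div_pow, div_pow, Real.sq_sqrt hM0.le]
    field_simp
    linear_combination hXY _ ha +
      (X (a + 1) ^ 2 + Y (a + 1) ^ 2) * Real.cos_sq_add_sin_sq (Θ (a + 1))
  have hsq : Tendsto (fun s => √(M s / s)) atTop (𝓝 √f) := hMf.sqrt
  have hc := (Real.continuous_cos.tendsto l).comp hΘ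
  have hs := (Real.continuous_sin.tendsto l).comp hΘ
  refine ⟨√f * (Real.cos l * p - Real.sin l * r), √f * (Real.sin l * p + Real.cos l * r),
    (hsq.mul ((hc.mul_const p).sub (hs.mul_const r))).congr' ?_,
    (hsq.mul ((hs.mul_const p).add (hc.mul_const r))).congr' ?_, ?_⟩
  · filter_upwards [eventually_gt_atTop a] with s has
    have h0 := Real.sqrt_pos.2 (hM s has)
    simp only [Function.comp]
    rw [← hp s has, ← hr s has, Real.sqrt_div (hM s has).le, div_eq_inv_mul]
    field_simp
    linear_combination (√s)⁻¹ * X s * Real.cos_sq_add_sin_sq (Θ s)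
  · filter_upwards [eventually_gt_atTop a] with s has
    have h0 := Real.sqrt_pos.2 (hM s has)
    simp only [Function.comp]
    rw [← hp s has, ← hr s has, Real.sqrt_div (hM s has).le, div_eq_inv_mul]
    field_simp
    linear_combination (√s)⁻¹ * Y s * Real.cos_sq_add_sin_sq (Θ s)
  · linear_combination (p ^ 2 + r ^ 2) * Real.sq_sqrt hf.le + f * hpr +
      √f ^ 2 * (p ^ 2 + r ^ 2) * Real.cos_sq_add_sin_sq l

/-- diffusive outgoing drift in the future.  For any C² solution
`q : [s*,∞) → ℝ²∖{0}` of `q̈ = −q̇^⊥ + f·q^⊥/|q|²` the limit `u = lim_{s→∞} q(s)/√s`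
exists in `ℝ²` and `|u| = √(2f)` (i.e. `u₁² + u₂² = 2f`). -/
theorem diffusive_drift_future
    (f : ℝ) (hf : 0 < f)
    (sstar : ℝ) (q q' : ℝ → ℝ × ℝ)
    (hq0 : ∀ s ∈ Ici sstar, q s ≠ 0)
    (hq : ∀ s ∈ Ici sstar, HasDerivWithinAt q (q' s) (Ici sstar) s)
    (hNewton : ∀ s ∈ Ici sstar, HasDerivWithinAt q'
      (-perp (q' s) + (f / ((q s).1 ^ 2 + (q s).2 ^ 2)) • perp (q s)) (Ici sstar) s) :
    ∃ u : ℝ × ℝ,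
      Tendsto (fun s : ℝ => (Real.sqrt s)⁻¹ • q s) atTop (𝓝 u) ∧
      u.1 ^ 2 + u.2 ^ 2 = 2 * f := by
  set x : ℝ → ℝ := fun s => (q s).1 with hx
  set y : ℝ → ℝ := fun s => (q s).2 with hy
  set v : ℝ → ℝ := fun s => (q' s).1 with hv
  set w : ℝ → ℝ := fun s => (q' s).2 with hw
  have hdx : ∀ s, sstar < s → HasDerivAt x (v s) s := fun s hs =>
    ((hq s hs.le).hasDerivAt (Ici_mem_nhds hs)).fst
  have hdy : ∀ s, sstar < s → HasDerivAt y (w s) s := fun s hs =>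
    ((hq s hs.le).hasDerivAt (Ici_mem_nhds hs)).snd
  have hdv : ∀ s, sstar < s → HasDerivAt v (w s - f / (x s ^ 2 + y s ^ 2) * y s) s :=
    fun s hs => by
      have h : HasDerivAt v _ s := ((hNewton s hs.le).hasDerivAt (Ici_mem_nhds hs)).fst
      refine h.congr_deriv ?_
      simp [perp, hx, hy, hw]
      ring
  have hdw : ∀ s, sstar < s → HasDerivAt w (-v s + f / (x s ^ 2 + y s ^ 2) * x s) s :=
    fun s hs => by
      have h : HasDerivAt w _ s := ((hNewton s hs.le).hasDerivAt (Ici_mem_nhds hs)).snd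
      refine h.congr_deriv ?_
      simp [perp, hx, hy, hv]
  have hR : ∀ s, sstar < s → 0 < x s ^ 2 + y s ^ 2 := fun s hs => by
    have h := hq0 s hs.le
    by_contra! hle
    refine h (Prod.ext ?_ ?_)
    · exact pow_eq_zero_iff two_ne_zero |>.1 (by nlinarith [sq_nonneg (x s), sq_nonneg (y s)] :
        x s ^ 2 = 0)
    · exact pow_eq_zero_iff two_ne_zero |>.1 (by nlinarith [sq_nonneg (x s), sq_nonneg (y s)] :
        y s ^ 2 = 0)
  set ρ : ℝ → ℝ := fun s => (x s ^ 2 + y s ^ 2) / 2 with hρdef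
  set E : ℝ → ℝ := fun s => (v s ^ 2 + w s ^ 2) / 2 with hEdef
  set g : ℝ → ℝ := fun s => x s * v s + y s * w s with hgdef
  set T : ℝ → ℝ := fun s => x s * w s - y s * v s + ρ s with hTdef
  have hρ : ∀ s, sstar < s → 0 < ρ s := fun s hs => half_pos (hR s hs)
  have hE : ∀ s, 0 ≤ E s := fun s => by positivity
  have hid : ∀ s, 4 * ρ s * E s = g s ^ 2 + (T s - ρ s) ^ 2 := fun s => by
    simp only [hρdef, hEdef, hgdef, hTdef]
    ring
  have hdρ : ∀ s, sstar < s → HasDerivAt ρ (g s) s := fun s hs => by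
    refine ((((hdx s hs).pow 2).add ((hdy s hs).pow 2)).div_const 2).congr_deriv ?_
    simp only [hgdef]
    ring
  have hdg : ∀ s, sstar < s → HasDerivAt g (2 * E s + T s - ρ s) s := fun s hs => by
    refine (((hdx s hs).mul (hdv s hs)).add ((hdy s hs).mul (hdw s hs))).congr_deriv ?_
    simp only [hTdef, hEdef]
    ring
  have hdE : ∀ s, sstar < s → HasDerivAt E (f * (T s - ρ s) / (2 * ρ s)) s := fun s hs => by
    refine ((((hdv s hs).pow 2).add ((hdw s hs).pow 2)).div_const 2).congr_deriv ?_
    have := (hR s hs).ne'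
    simp only [hTdef, hρdef]
    field_simp
    ring
  have hdT : ∀ s, sstar < s → HasDerivAt T f s := fun s hs => by
    refine ((((hdx s hs).mul (hdw s hs)).sub ((hdy s hs).mul (hdv s hs))).add
      (hdρ s hs)).congr_deriv ?_
    have := (hR s hs).ne'
    simp only [hgdef]
    field_simp
    ring
  obtain ⟨c, hc⟩ : ∃ c, ∀ s, sstar < s → T s - f * s = c :=
    isOpen_Ioi.exists_is_const_of_deriv_eq_zero isPreconnected_Ioi
      (fun s hs => ((hdT s hs).sub ((hasDerivAt_id s).const_mul
        f)).differentiableAt.differentiableWithinAt)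
      (fun s hs => (((hdT s hs).sub ((hasDerivAt_id s).const_mul f)).congr_deriv
        (by simp)).deriv)
  have hTtop : Tendsto T atTop atTop := by
    refine (tendsto_atTop_add_const_right _ c (tendsto_id.const_mul_atTop hf)).congr' ?_
    filter_upwards [eventually_gt_atTop sstar] with s hs
    simp [← hc s hs]
  obtain ⟨b, hb⟩ := eventually_atTop.1
    ((hTtop.eventually_gt_atTop 0).and (eventually_gt_atTop sstar))
  obtain ⟨K, hK⟩ := exists_energy_bound (a := b) hf (fun s hs => hρ s (hb s hs.le).2)
    (fun s hs => (hb s hs.le).1) (fun s _ => hE s) (fun s _ => hid s)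
    (fun s hs => hdρ s (hb s hs.le).2) (fun s hs => hdg s (hb s hs.le).2)
    (fun s hs => hdE s (hb s hs.le).2) (fun s hs => hdT s (hb s hs.le).2)
  obtain ⟨a, ha⟩ := eventually_atTop.1
    ((hTtop.eventually_ge_atTop K).and (eventually_ge_atTop (b + 1)))
  have hba : ∀ s, a < s → b ≤ s := fun s hs => by linarith [(ha s hs.le).2]
  have hsa : ∀ s, a < s → sstar < s := fun s hs => (hb s (hba s hs)).2
  have hTa : ∀ s, a < s → 0 < T s := fun s hs => (hb s (hba s hs)).1
  have hKa : ∀ s, a < s → E s ≤ K := fun s hs => hK s (ha s hs.le).2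
  obtain ⟨l, hl⟩ := exists_tendsto_guidingAngle hf (fun s hs => hρ s (hsa s hs)) hTa
    (fun s _ => hE s) (fun s _ => hid s) (fun s hs => hdρ s (hsa s hs))
    (fun s hs => hdg s (hsa s hs)) (fun s hs => hdE s (hsa s hs)) (fun s hs => hdT s (hsa s hs))
    hKa (fun s hs => (ha s hs.le).1) hTtop
  have hMa : ∀ s, a < s → 0 < T s + E s := fun s hs => add_pos_of_pos_of_nonneg (hTa s hs) (hE s)
  have hMf : Tendsto (fun s => (T s + E s) / s) atTop (𝓝 f) := by
    have hEs : Tendsto (fun s => E s / s) atTop (𝓝 0) := by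
      refine squeeze_zero' ?_ ?_ (tendsto_const_nhds (x := K).div_atTop tendsto_id)
      · filter_upwards [eventually_ge_atTop 0] with s hs
        exact div_nonneg (hE s) hs
      · filter_upwards [eventually_gt_atTop a, eventually_ge_atTop 0] with s hs hs0
        exact div_le_div_of_nonneg_right (hKa s hs) hs0
    have h := (hEs.add (tendsto_const_nhds (x := c).div_atTop tendsto_id)).const_add f
    simp only [add_zero] at h
    refine h.congr' ?_
    filter_upwards [eventually_gt_atTop a, eventually_gt_atTop 0] with s hs hs0
    simp only [id, ← hc s (hsa s hs)]
    field_simp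
    ring
  obtain ⟨u₁, u₂, h₁, h₂, hu⟩ := exists_tendsto_div_sqrt_of_polar
    (X := fun s => x s + w s) (Y := fun s => y s - v s) hMa
    (fun s _ => by
      simp only [hTdef, hρdef, hEdef]
      ring)
    (fun s hs => (hdT s (hsa s hs)).add (hdE s (hsa s hs)))
    (fun s hs => hasDerivAt_guidingAngle hf (hρ s (hsa s hs)) (hTa s hs) (hE s) (hid s)
      (hdρ s (hsa s hs)) (hdg s (hsa s hs)) (hdE s (hsa s hs)) (hdT s (hsa s hs)))
    (fun s hs => by
      refine ((hdx s (hsa s hs)).add (hdw s (hsa s hs))).congr_deriv ?_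
      have key : 2 * x s * (T s + E s) = (T s + ρ s) * (x s + w s) - g s * (y s - v s) := by
        simp only [hTdef, hρdef, hEdef, hgdef]
        ring
      have hM := (hMa s hs).ne'
      have hρ0 := (hρ s (hsa s hs)).ne'
      rw [show x s ^ 2 + y s ^ 2 = 2 * ρ s by simp only [hρdef]; ring]
      field_simp
      linear_combination key)
    (fun s hs => by
      refine ((hdy s (hsa s hs)).sub (hdv s (hsa s hs))).congr_deriv ?_
      have key : 2 * y s * (T s + E s) = (T s + ρ s) * (y s - v s) + g s * (x s + w s) := by
        simp only [hTdef, hρdef, hEdef, hgdef]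
        ring
      have hM := (hMa s hs).ne'
      have hρ0 := (hρ s (hsa s hs)).ne'
      rw [show x s ^ 2 + y s ^ 2 = 2 * ρ s by simp only [hρdef]; ring]
      field_simp
      linear_combination key)
    hMf hf hl
  have hsmall : ∀ z : ℝ → ℝ, (∀ s, z s ^ 2 ≤ 2 * E s) →
      Tendsto (fun s => (√s)⁻¹ * z s) atTop (𝓝 0) := fun z hz => by
    have h0 := (Real.tendsto_sqrt_atTop.inv_tendsto_atTop).mul_const √(2 * K)
    rw [zero_mul] at h0
    refine squeeze_zero_norm' ?_ h0
    filter_upwards [eventually_gt_atTop a] with s hs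
    rw [norm_mul, Real.norm_of_nonneg (by positivity), Pi.inv_apply]
    refine mul_le_mul_of_nonneg_left (Real.abs_le_sqrt ?_) (by positivity)
    linarith [hz s, hKa s hs]
  have hv0 := hsmall v fun s => by
    simp only [hEdef]
    nlinarith [sq_nonneg (w s)]
  have hw0 := hsmall w fun s => by
    simp only [hEdef]
    nlinarith [sq_nonneg (v s)]
  refine ⟨(u₁, u₂), ?_, hu⟩
  have h₁' := h₁.sub hw0
  have h₂' := h₂.add hv0
  rw [sub_zero] at h₁'
  rw [add_zero] at h₂'
  refine (h₁'.prodMk_nhds h₂').congr fun s => Prod.ext ?_ ?_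
  · simp only [Prod.smul_fst, smul_eq_mul, hx]
    ring
  · simp only [Prod.smul_snd, smul_eq_mul, hy]
    ring
end
end

section
/- Let f > 0 and let q : (−∞, s*] → ℝ²∖{0} be a C² solution of q̈(s) = −q̇(s)^⊥ + f·q(s)^⊥/|q(s)|², and set I₂(s) := |q̇(s)|²/2. Then lim_{s→−∞} I₂(s)/s = −f: in the far past the energy grows linearly backwards in time, i.e. the particle loses kinetic energy at the constant rate f as time advances. (In the original physical units this reads H(t)/t → −(e²B/m)·Φ₀/(2π) as t → −∞.) -/
open Set Filter Topology

noncomputable section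

/-- A function whose derivative tends to `0` at `-∞` grows sublinearly there. -/
theorem tendsto_div_atBot_of_deriv_tendsto_zero {F F' : ℝ → ℝ}
    (hF : ∀ᶠ s in atBot, HasDerivAt F (F' s) s) (hF' : Tendsto F' atBot (𝓝 0)) :
    Tendsto (fun s => F s / s) atBot (𝓝 0) := by
  rw [Metric.tendsto_nhds]
  intro ε hε
  have hsmall : ∀ᶠ s in atBot, |F' s| < ε / 2 := by
    have := (Metric.tendsto_nhds.1 hF') (ε / 2) (by positivity)
    simpa [Real.dist_eq] using this
  obtain ⟨b, hb⟩ := eventually_atBot.1 (hF.and hsmall)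
  have hlip : ∀ s ≤ b, |F s - F b| ≤ ε / 2 * |s - b| := fun s hs => by
    have := (convex_Iic b).norm_image_sub_le_of_norm_hasDerivWithin_le
      (f := F) (f' := F') (C := ε / 2) (x := b) (y := s)
      (fun x hx => (hb x hx).1.hasDerivWithinAt) (fun x hx => (hb x hx).2.le) self_mem_Iic hs
    simpa [Real.norm_eq_abs] using this
  have hfar : ∀ᶠ s : ℝ in atBot, s < -(2 / ε * (|F b| + ε / 2 * |b|)) := eventually_lt_atBot _
  filter_upwards [eventually_le_atBot b, hfar, eventually_lt_atBot (0 : ℝ)] with s hsb hs hs0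
  rw [Real.dist_eq, sub_zero, abs_div, div_lt_iff₀ (abs_pos.2 hs0.ne), abs_of_neg hs0]
  have h1 := hlip s hsb
  have h2 : |s - b| ≤ -s + |b| := by
    have := abs_sub s b
    rwa [abs_of_neg hs0] at this
  have h3 : |F s| ≤ |F s - F b| + |F b| := by
    simpa using abs_add_le (F s - F b) (F b)
  have h4 : |F b| + ε / 2 * |b| < ε / 2 * (-s) := by
    have := mul_lt_mul_of_pos_left hs (by positivity : 0 < ε / 2)
    have h5 : ε / 2 * -(2 / ε * (|F b| + ε / 2 * |b|)) = -(|F b| + ε / 2 * |b|) := by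
      field_simp
    linarith
  nlinarith [mul_le_mul_of_nonneg_left h2 (by positivity : 0 ≤ ε / 2)]

section PlanarMotion

variable {f s : ℝ} {x y u v : ℝ → ℝ}

/-- Time derivative of the angular momentum. -/
theorem hasDerivAt_angularMomentum
    (hx : HasDerivAt x (u s) s) (hy : HasDerivAt y (v s) s)
    (hu : HasDerivAt u (v s - f / (x s ^ 2 + y s ^ 2) * y s) s)
    (hv : HasDerivAt v (-u s + f / (x s ^ 2 + y s ^ 2) * x s) s)
    (h0 : x s ^ 2 + y s ^ 2 ≠ 0) :
    HasDerivAt (fun s => x s * v s - y s * u s) (f - (x s * u s + y s * v s)) s := by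
  refine ((hx.mul hv).sub (hy.mul hu)).congr_deriv ?_
  field_simp
  ring

/-- Time derivative of the radial momentum `⟨q, q̇⟩`. -/
theorem hasDerivAt_radialMomentum
    (hx : HasDerivAt x (u s) s) (hy : HasDerivAt y (v s) s)
    (hu : HasDerivAt u (v s - f / (x s ^ 2 + y s ^ 2) * y s) s)
    (hv : HasDerivAt v (-u s + f / (x s ^ 2 + y s ^ 2) * x s) s) :
    HasDerivAt (fun s => x s * u s + y s * v s)
      (u s ^ 2 + v s ^ 2 + (x s * v s - y s * u s)) s := by
  refine ((hx.mul hu).add (hy.mul hv)).congr_deriv ?_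
  ring

/-- Time derivative of the kinetic energy. -/
theorem hasDerivAt_energy
    (hu : HasDerivAt u (v s - f / (x s ^ 2 + y s ^ 2) * y s) s)
    (hv : HasDerivAt v (-u s + f / (x s ^ 2 + y s ^ 2) * x s) s) :
    HasDerivAt (fun s => (u s ^ 2 + v s ^ 2) / 2)
      (f * ((x s * v s - y s * u s) / (x s ^ 2 + y s ^ 2))) s := by
  refine (((hu.pow 2).add (hv.pow 2)).div_const 2).congr_deriv ?_
  push_cast
  ring

/-- Up to the bounded term `f * arctan (P / L)`, where `P` and `L` are the radial and the angular
momentum, `I₂ + f * s` varies at the rate `f² P / (P² + L²)`. -/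
theorem hasDerivAt_correctedEnergy
    (hx : HasDerivAt x (u s) s) (hy : HasDerivAt y (v s) s)
    (hu : HasDerivAt u (v s - f / (x s ^ 2 + y s ^ 2) * y s) s)
    (hv : HasDerivAt v (-u s + f / (x s ^ 2 + y s ^ 2) * x s) s)
    (h0 : x s ^ 2 + y s ^ 2 ≠ 0) (hL : x s * v s - y s * u s ≠ 0) :
    HasDerivAt (fun s => (u s ^ 2 + v s ^ 2) / 2 + f * s
        - f * Real.arctan ((x s * u s + y s * v s) / (x s * v s - y s * u s)))
      (f ^ 2 * ((x s * u s + y s * v s) /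
        ((x s * u s + y s * v s) ^ 2 + (x s * v s - y s * u s) ^ 2))) s := by
  have hP := hasDerivAt_radialMomentum hx hy hu hv
  have hA := (hP.div (hasDerivAt_angularMomentum hx hy hu hv h0) hL).arctan
  refine (((hasDerivAt_energy (x := x) (y := y) hu hv).add
    ((hasDerivAt_id s).const_mul f)).sub (hA.const_mul f)).congr_deriv ?_
  have hD : (x s * u s + y s * v s) ^ 2 + (x s * v s - y s * u s) ^ 2
      = (x s ^ 2 + y s ^ 2) * (u s ^ 2 + v s ^ 2) := by ring
  have hD0 : (x s * u s + y s * v s) ^ 2 + (x s * v s - y s * u s) ^ 2 ≠ 0 := by positivity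
  have hw : u s ^ 2 + v s ^ 2 ≠ 0 := right_ne_zero_of_mul (hD ▸ hD0)
  simp only [Pi.div_apply]
  generalize hPe : x s * u s + y s * v s = P at *
  generalize hLe : x s * v s - y s * u s = L at *
  have hD1 : L ^ 2 + P ^ 2 ≠ 0 := by rwa [add_comm]
  have hr : L / (x s ^ 2 + y s ^ 2) = L * (u s ^ 2 + v s ^ 2) / (P ^ 2 + L ^ 2) := by
    rw [hD]; field_simp
  rw [hr]
  field_simp
  ring

end PlanarMotion

/-- linear energy loss in the past.  For any C² solution
`q : (−∞,s*] → ℝ²∖{0}` of `q̈ = −q̇^⊥ + f·q^⊥/|q|²`, with `I₂ = |q̇|²/2`, one has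
`lim_{s→−∞} I₂(s)/s = −f`: in the far past the energy grows linearly backwards in time. -/
theorem energy_linear_loss_past
    (f : ℝ) (hf : 0 < f)
    (sstar : ℝ) (q q' : ℝ → ℝ × ℝ)
    (hq0 : ∀ s ∈ Iic sstar, q s ≠ 0)
    (hq : ∀ s ∈ Iic sstar, HasDerivWithinAt q (q' s) (Iic sstar) s)
    (hNewton : ∀ s ∈ Iic sstar, HasDerivWithinAt q'
      (-perp (q' s) + (f / ((q s).1 ^ 2 + (q s).2 ^ 2)) • perp (q s)) (Iic sstar) s)
    (I₂ : ℝ → ℝ) (hI₂ : ∀ s, I₂ s = ((q' s).1 ^ 2 + (q' s).2 ^ 2) / 2) :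
    Tendsto (fun s : ℝ => I₂ s / s) atBot (𝓝 (-f)) := by
  set x : ℝ → ℝ := fun s => (q s).1 with hxdef
  set y : ℝ → ℝ := fun s => (q s).2 with hydef
  set u : ℝ → ℝ := fun s => (q' s).1 with hudef
  set v : ℝ → ℝ := fun s => (q' s).2 with hvdef
  have hx : ∀ s < sstar, HasDerivAt x (u s) s := fun s hs =>
    ((hq s hs.le).hasDerivAt (Iic_mem_nhds hs)).fst
  have hy : ∀ s < sstar, HasDerivAt y (v s) s := fun s hs =>
    ((hq s hs.le).hasDerivAt (Iic_mem_nhds hs)).snd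
  have hu : ∀ s < sstar, HasDerivAt u (v s - f / (x s ^ 2 + y s ^ 2) * y s) s := fun s hs => by
    refine (HasFDerivAt.hasDerivAt
      ((hNewton s hs.le).hasDerivAt (Iic_mem_nhds hs)).fst).congr_deriv ?_
    simp [perp, hxdef, hydef, hvdef, sub_eq_add_neg]
  have hv : ∀ s < sstar, HasDerivAt v (-u s + f / (x s ^ 2 + y s ^ 2) * x s) s := fun s hs => by
    refine (HasFDerivAt.hasDerivAt
      ((hNewton s hs.le).hasDerivAt (Iic_mem_nhds hs)).snd).congr_deriv ?_
    simp [perp, hxdef, hydef, hudef]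
  have h0 : ∀ s < sstar, x s ^ 2 + y s ^ 2 ≠ 0 := fun s hs h => by
    have hx0 : x s = 0 := by nlinarith [sq_nonneg (x s), sq_nonneg (y s)]
    have hy0 : y s = 0 := by nlinarith [sq_nonneg (x s), sq_nonneg (y s)]
    exact hq0 s hs.le (Prod.ext hx0 hy0)
  set P : ℝ → ℝ := fun s => x s * u s + y s * v s
  set L : ℝ → ℝ := fun s => x s * v s - y s * u s
  -- `L + |q|²/2 - f s` is conserved, so that `L` is below an affine function of slope `f`
  obtain ⟨C, hC⟩ : ∃ C, ∀ s < sstar, L s ≤ f * s + C := by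
    refine ⟨L (sstar - 1) + (x (sstar - 1) ^ 2 + y (sstar - 1) ^ 2) / 2 - f * (sstar - 1),
      fun s hs => ?_⟩
    have hder : ∀ s ∈ Iio sstar, HasDerivWithinAt
        (fun s => L s + (x s ^ 2 + y s ^ 2) / 2 - f * s) 0 (Iio sstar) s := fun s hs => by
      have hLs := hasDerivAt_angularMomentum (hx s hs) (hy s hs) (hu s hs) (hv s hs) (h0 s hs)
      refine HasDerivAt.hasDerivWithinAt (((hLs.add
        ((((hx s hs).pow 2).add ((hy s hs).pow 2)).div_const 2)).sub
        ((hasDerivAt_id s).const_mul f)).congr_deriv ?_)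
      push_cast
      ring
    have hconst := (convex_Iio sstar).norm_image_sub_le_of_norm_hasDerivWithin_le
      (C := 0) (x := sstar - 1) (y := s) hder (by simp) (by simp) hs
    rw [zero_mul, norm_le_zero_iff, sub_eq_zero] at hconst
    nlinarith [sq_nonneg (x s), sq_nonneg (y s)]
  have haff : Tendsto (fun s => f * s + C) atBot atBot :=
    tendsto_atBot_add_const_right _ _ (tendsto_id.const_mul_atBot hf)
  have hLbot : Tendsto L atBot atBot := by
    refine tendsto_atBot_mono' _ ?_ haff
    filter_upwards [eventually_lt_atBot sstar] with s hs using hC s hs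
  have hrate : Tendsto (fun s => f ^ 2 * (P s / (P s ^ 2 + L s ^ 2))) atBot (𝓝 0) := by
    rw [← mul_zero (f ^ 2)]
    refine Tendsto.const_mul _ ?_
    have hinv : Tendsto (fun s => |L s|⁻¹) atBot (𝓝 0) :=
      (tendsto_abs_atBot_atTop.comp hLbot).inv_tendsto_atTop
    refine squeeze_zero_norm' ?_ hinv
    filter_upwards [hLbot.eventually_lt_atBot 0] with s hs
    have hD : 0 < P s ^ 2 + L s ^ 2 := by nlinarith [sq_nonneg (P s)]
    rw [Real.norm_eq_abs, abs_div, abs_of_pos hD, div_le_iff₀ hD, ← div_eq_inv_mul,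
      le_div_iff₀ (abs_pos.2 hs.ne), ← sq_abs (P s), ← sq_abs (L s)]
    nlinarith [sq_nonneg (|P s| - |L s|), sq_nonneg (|P s| + |L s|)]
  have hF := tendsto_div_atBot_of_deriv_tendsto_zero
    (F := fun s => (u s ^ 2 + v s ^ 2) / 2 + f * s - f * Real.arctan (P s / L s)) (by
      filter_upwards [eventually_lt_atBot sstar, hLbot.eventually_lt_atBot 0] with s hs hLs
      exact hasDerivAt_correctedEnergy (hx s hs) (hy s hs) (hu s hs) (hv s hs) (h0 s hs) hLs.ne)
    hrate
  have harctan : Tendsto (fun s => f * (Real.arctan (P s / L s) * s⁻¹)) atBot (𝓝 (f * 0)) := by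
    refine Tendsto.const_mul _ (bdd_le_mul_tendsto_zero' (Real.pi / 2) ?_ tendsto_inv_atBot_zero)
    exact Eventually.of_forall fun s =>
      abs_le.2 ⟨(Real.neg_pi_div_two_lt_arctan _).le, (Real.arctan_lt_pi_div_two _).le⟩
  have hlim := (hF.add harctan).sub_const f
  rw [mul_zero, add_zero, zero_sub] at hlim
  refine hlim.congr' ?_
  filter_upwards [eventually_lt_atBot (0 : ℝ)] with s hs
  have hs0 := hs.ne
  rw [hI₂]
  field_simp
  ring
end
end

section
/- Let f > 0 and let q : (−∞, s*] → ℝ²∖{0} be a C² solution of q̈(s) = −q̇(s)^⊥ + f·q(s)^⊥/|q(s)|². Then lim_{s→−∞} |q(s)|/√|s| = √(2f), and there exists δ ∈ ℝ such that |q(s)/|q(s)| − e(−s + δ)| → 0 as s → −∞: in the far past the particle spirals inward, its distance to the flux line growing like √(2f|s|) backwards in time while its direction rotates clockwise with unit angular speed. (In the original physical units: q(t)/√|t| ∼ √(Φ₀/(2πB))·e(−ωt) as t → −∞.) -/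
open Set Filter Topology

noncomputable section

open Complex ComplexConjugate

/-- Guiding centre `c` and velocity `w` of the particle in reversed, shifted time, so that the
particle itself is at `c + I * w`. -/
structure IsGuidingCenterSolution (f T : ℝ) (c w : ℝ → ℂ) : Prop where
  hasDerivAt_center : ∀ t, T < t → HasDerivAt c (-(f / conj (c t + I * w t))) t
  hasDerivAt_velocity : ∀ t, T < t →
    HasDerivAt w (I * w t - I * (f / conj (c t + I * w t))) t
  norm_velocity_sq : ∀ t, T < t → ‖w t‖ ^ 2 = ‖c t‖ ^ 2 + 2 * f * t

/-- The position relative to the rotating radius vector `I * w`. -/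
def relPos (c w : ℝ → ℂ) (t : ℝ) : ℂ := 1 - I * (c t / w t)

namespace IsGuidingCenterSolution

variable {f T t : ℝ} {c w : ℝ → ℂ}

lemma norm_center_lt (h : IsGuidingCenterSolution f T c w) (hf : 0 < f) (hT : 0 ≤ T)
    (ht : T < t) : ‖c t‖ < ‖w t‖ := by
  have := h.norm_velocity_sq t ht
  have : 0 < f * t := mul_pos hf (hT.trans_lt ht)
  exact lt_of_pow_lt_pow_left₀ 2 (norm_nonneg _) (by linarith)

lemma norm_velocity_pos (h : IsGuidingCenterSolution f T c w) (hf : 0 < f) (hT : 0 ≤ T)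
    (ht : T < t) : 0 < ‖w t‖ :=
  (norm_nonneg _).trans_lt (h.norm_center_lt hf hT ht)

lemma velocity_ne_zero (h : IsGuidingCenterSolution f T c w) (hf : 0 < f) (hT : 0 ≤ T)
    (ht : T < t) : w t ≠ 0 :=
  norm_pos_iff.1 (h.norm_velocity_pos hf hT ht)

lemma norm_relPos_sub_one : ‖relPos c w t - 1‖ = ‖c t‖ / ‖w t‖ := by
  simp [relPos]

lemma norm_relPos_sub_one_lt (h : IsGuidingCenterSolution f T c w) (hf : 0 < f) (hT : 0 ≤ T)
    (ht : T < t) : ‖relPos c w t - 1‖ < 1 := by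
  rw [norm_relPos_sub_one, div_lt_one (h.norm_velocity_pos hf hT ht)]
  exact h.norm_center_lt hf hT ht

lemma relPos_re_pos (h : IsGuidingCenterSolution f T c w) (hf : 0 < f) (hT : 0 ≤ T)
    (ht : T < t) : 0 < (relPos c w t).re := by
  have h1 := (abs_le.1 (Complex.abs_re_le_norm (relPos c w t - 1))).1
  have h2 := h.norm_relPos_sub_one_lt hf hT ht
  simp only [sub_re, one_re] at h1
  linarith

lemma relPos_ne_zero (h : IsGuidingCenterSolution f T c w) (hf : 0 < f) (hT : 0 ≤ T)
    (ht : T < t) : relPos c w t ≠ 0 := fun h0 => by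
  simpa [h0] using h.relPos_re_pos hf hT ht

lemma position_eq (hw : w t ≠ 0) : c t + I * w t = I * w t * relPos c w t := by
  simp only [relPos]
  field_simp
  linear_combination c t * I_sq

lemma div_conj_position (hw : w t ≠ 0) :
    (f : ℂ) / conj (c t + I * w t) = I * (w t * (f / ‖w t‖ ^ 2 * (conj (relPos c w t))⁻¹)) := by
  rw [position_eq hw]
  have h1 : conj (w t) * w t = (‖w t‖ : ℂ) ^ 2 := by
    rw [mul_comm, mul_conj, normSq_eq_norm_sq]; push_cast; rfl
  have h2 : conj (w t) ≠ 0 := (map_ne_zero _).2 hw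
  rw [← h1, map_mul, map_mul, conj_I]
  by_cases h3 : conj (relPos c w t) = 0
  · simp [h3]
  · field_simp
    linear_combination (-(f : ℂ)) * I_sq

lemma hasDerivAt_velocity' (h : IsGuidingCenterSolution f T c w) (hf : 0 < f) (hT : 0 ≤ T)
    (ht : T < t) :
    HasDerivAt w (w t * (I + f / ‖w t‖ ^ 2 * (conj (relPos c w t))⁻¹)) t := by
  convert h.hasDerivAt_velocity t ht using 1
  rw [div_conj_position (h.velocity_ne_zero hf hT ht)]
  linear_combination (w t * (f / ‖w t‖ ^ 2 * (conj (relPos c w t))⁻¹)) * I_sq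

lemma hasDerivAt_relPos (h : IsGuidingCenterSolution f T c w) (hf : 0 < f) (hT : 0 ≤ T)
    (ht : T < t) :
    HasDerivAt (relPos c w) (-I * (relPos c w t - 1) -
      f / ‖w t‖ ^ 2 * (conj (relPos c w t))⁻¹ * relPos c w t) t := by
  have hw := h.velocity_ne_zero hf hT ht
  have hc := h.hasDerivAt_center t ht
  rw [div_conj_position hw] at hc
  refine (((hc.div (h.hasDerivAt_velocity' hf hT ht) hw).const_mul I).const_sub 1).congr_deriv ?_
  generalize (f : ℂ) / ‖w t‖ ^ 2 * (conj (relPos c w t))⁻¹ = b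
  simp only [relPos]
  field_simp
  linear_combination (w t * b) * I_sq

lemma hasDerivAt_log_relPos (h : IsGuidingCenterSolution f T c w) (hf : 0 < f) (hT : 0 ≤ T)
    (ht : T < t) :
    HasDerivAt (fun t => Complex.log (relPos c w t)) (-I * (1 - (relPos c w t)⁻¹) -
      f / ‖w t‖ ^ 2 * (conj (relPos c w t))⁻¹) t := by
  have ha := h.relPos_ne_zero hf hT ht
  convert (h.hasDerivAt_relPos hf hT ht).clog_real (Or.inl (h.relPos_re_pos hf hT ht)) using 1
  field_simp

lemma hasDerivAt_norm_velocity_sq (h : IsGuidingCenterSolution f T c w) (hf : 0 < f)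
    (hT : 0 ≤ T) (ht : T < t) :
    HasDerivAt (fun t => ‖w t‖ ^ 2) (2 * f * ((relPos c w t)⁻¹).re) t := by
  have hw := h.norm_velocity_pos hf hT ht
  convert (h.hasDerivAt_velocity' hf hT ht).norm_sq using 1
  have h1 : conj (w t) * w t = ((‖w t‖ ^ 2 : ℝ) : ℂ) := by
    rw [mul_comm, mul_conj, normSq_eq_norm_sq]
  have h2 : (f : ℂ) / ‖w t‖ ^ 2 = ((f / ‖w t‖ ^ 2 : ℝ) : ℂ) := by push_cast; rfl
  rw [Complex.inner, mul_comm _ (conj (w t)), ← mul_assoc, h1, re_ofReal_mul, ← map_inv₀, h2,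
    add_re, re_ofReal_mul, conj_re, I_re]
  field_simp
  ring

lemma re_inv_relPos_nonneg (h : IsGuidingCenterSolution f T c w) (hf : 0 < f)
    (hT : 0 ≤ T) (ht : T < t) : 0 ≤ ((relPos c w t)⁻¹).re := by
  rw [inv_re]
  exact div_nonneg (h.relPos_re_pos hf hT ht).le (normSq_nonneg _)

lemma re_inv_relPos_le (h : IsGuidingCenterSolution f T c w) (hf : 0 < f)
    (hT : 0 ≤ T) (ht : T < t) : f * t * ((relPos c w t)⁻¹).re ≤ ‖w t‖ ^ 2 := by
  have hw := h.norm_velocity_pos hf hT ht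
  have hft : 0 < f * t := mul_pos hf (hT.trans_lt ht)
  have ha : 0 < ‖relPos c w t‖ := norm_pos_iff.2 (h.relPos_ne_zero hf hT ht)
  have h1 : f * t ≤ ‖w t‖ ^ 2 * ‖relPos c w t‖ := by
    have h2 : 1 - ‖c t‖ / ‖w t‖ ≤ ‖relPos c w t‖ := by
      rw [← norm_relPos_sub_one (c := c) (w := w)]
      have := norm_sub_norm_le (1 : ℂ) (1 - relPos c w t)
      rw [norm_sub_rev 1, norm_one, sub_sub_cancel] at this
      exact this
    calc f * t ≤ ‖w t‖ ^ 2 * (1 - ‖c t‖ / ‖w t‖) := by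
          have h3 : ‖w t‖ ^ 2 * (1 - ‖c t‖ / ‖w t‖) = ‖w t‖ * (‖w t‖ - ‖c t‖) := by
            field_simp
          rw [h3]
          nlinarith [h.norm_velocity_sq t ht, sq_nonneg (‖w t‖ - ‖c t‖)]
      _ ≤ _ := by gcongr
  calc f * t * ((relPos c w t)⁻¹).re ≤ f * t * ‖relPos c w t‖⁻¹ := by
        gcongr
        rw [← norm_inv]
        exact re_le_norm _
    _ ≤ ‖w t‖ ^ 2 := by
        rwa [← div_eq_mul_inv, div_le_iff₀ ha]

lemma re_log_relPos_le (h : IsGuidingCenterSolution f T c w) (hf : 0 < f)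
    (hT : 0 ≤ T) (ht : T < t) : (Complex.log (relPos c w t)).re ≤ 1 := by
  rw [log_re]
  have ha : 0 < ‖relPos c w t‖ := norm_pos_iff.2 (h.relPos_ne_zero hf hT ht)
  have h1 := norm_add_le (relPos c w t - 1) 1
  rw [sub_add_cancel, norm_one] at h1
  linarith [Real.log_le_sub_one_of_pos ha, h.norm_relPos_sub_one_lt hf hT ht]

/-- The adiabatic invariant `‖c‖² / 2 - f arg (relPos)`, corrected to the next order. -/
def adiabaticInvariant (f : ℝ) (c w : ℝ → ℂ) (t : ℝ) : ℝ :=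
  ‖w t‖ ^ 2 / 2 - f * t - f * (Complex.log (relPos c w t)).im -
    f ^ 2 * ((‖w t‖ ^ 2)⁻¹ * (Complex.log (relPos c w t)).re)

lemma hasDerivAt_adiabaticInvariant (h : IsGuidingCenterSolution f T c w) (hf : 0 < f)
    (hT : 0 ≤ T) (ht : T < t) :
    HasDerivAt (adiabaticInvariant f c w) (f ^ 3 / ‖w t‖ ^ 4 * ((relPos c w t)⁻¹).re *
      (1 + 2 * (Complex.log (relPos c w t)).re)) t := by
  have hw := h.norm_velocity_pos hf hT ht
  have hL := h.hasDerivAt_log_relPos hf hT ht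
  have hW := h.hasDerivAt_norm_velocity_sq hf hT ht
  have hre := reCLM.hasFDerivAt.comp_hasDerivAt t hL
  have him := imCLM.hasFDerivAt.comp_hasDerivAt t hL
  have hy := hW.inv (by positivity)
  refine ((((hW.div_const 2).sub ((hasDerivAt_id t).const_mul f)).sub (him.const_mul f)).sub
    ((hy.mul hre).const_mul (f ^ 2))).congr_deriv ?_
  have h1 : (f : ℂ) / ‖w t‖ ^ 2 = ((f / ‖w t‖ ^ 2 : ℝ) : ℂ) := by push_cast; rfl
  rw [h1, ← map_inv₀]
  simp only [reCLM_apply, imCLM_apply, Function.comp_apply, Pi.inv_apply, sub_re, sub_im,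
    ofReal_re, ofReal_im, conj_re, conj_im, mul_re, mul_im, neg_re, neg_im, I_re, I_im, one_re,
    one_im]
  field_simp
  ring

lemma exists_norm_center_le (h : IsGuidingCenterSolution f T c w) (hf : 0 < f) (hT : 0 ≤ T) :
    ∃ C, 0 ≤ C ∧ ∀ t, T + 1 < t → ‖c t‖ ≤ C := by
  have hanti : AntitoneOn (fun t => adiabaticInvariant f c w t + 2 * f * t⁻¹) (Ioi T) := by
    have hd : ∀ t ∈ Ioi T, HasDerivAt (fun t => adiabaticInvariant f c w t + 2 * f * t⁻¹)
        (f ^ 3 / ‖w t‖ ^ 4 * ((relPos c w t)⁻¹).re *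
          (1 + 2 * (Complex.log (relPos c w t)).re) + 2 * f * (-(t ^ 2)⁻¹)) t := fun t ht =>
      (h.hasDerivAt_adiabaticInvariant hf hT ht).add
        ((hasDerivAt_inv (hT.trans_lt ht).ne').const_mul _)
    refine antitoneOn_of_hasDerivWithinAt_nonpos (convex_Ioi T)
      (fun t ht => (hd t ht).continuousAt.continuousWithinAt)
      (fun t ht => (hd t (interior_subset ht)).hasDerivWithinAt) fun t ht => ?_
    rw [interior_Ioi] at ht
    have ht : T < t := ht
    have htp : 0 < t := hT.trans_lt ht
    have hw := h.norm_velocity_pos hf hT ht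
    have hR := h.re_inv_relPos_nonneg hf hT ht
    have hR' := h.re_inv_relPos_le hf hT ht
    have hl := h.re_log_relPos_le hf hT ht
    have hW : 2 * f * t ≤ ‖w t‖ ^ 2 := by
      rw [h.norm_velocity_sq t ht]; linarith [sq_nonneg ‖c t‖]
    set R := ((relPos c w t)⁻¹).re
    set W := ‖w t‖ ^ 2 with hWdef
    have hWp : 0 < W := by positivity
    have hW4 : ‖w t‖ ^ 4 = W ^ 2 := by rw [hWdef]; ring
    have h1 : f ^ 3 / ‖w t‖ ^ 4 * R * (1 + 2 * (Complex.log (relPos c w t)).re) ≤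
        f ^ 3 / ‖w t‖ ^ 4 * R * 3 := by
      gcongr
      linarith
    have h2 : f ^ 3 / ‖w t‖ ^ 4 * R * 3 ≤ 2 * f * (t ^ 2)⁻¹ := by
      rw [hW4, ← div_eq_mul_inv, div_mul_eq_mul_div, div_mul_eq_mul_div,
        div_le_div_iff₀ (by positivity) (by positivity)]
      have h3 : (2 * f * t) * (f * t * R) ≤ W * W :=
        mul_le_mul hW hR' (by positivity) hWp.le
      nlinarith [mul_le_mul_of_nonneg_left h3 hf.le, mul_pos hf (mul_pos hWp hWp)]
    linarith
  set K := adiabaticInvariant f c w (T + 1) + 2 * f * (T + 1)⁻¹ + f * Real.pi + f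
  refine ⟨Real.sqrt (2 * |K|), Real.sqrt_nonneg _, fun t ht => Real.le_sqrt_of_sq_le ?_⟩
  have htT : T < t := by linarith
  have htp : 0 < t := hT.trans_lt htT
  have h1 := hanti (show T < T + 1 by linarith) htT ht.le
  have h2 := h.norm_velocity_sq t htT
  have h3 : (Complex.log (relPos c w t)).im ≤ Real.pi := log_im_le_pi _
  have hl := h.re_log_relPos_le hf hT htT
  have hW : 2 * f * t ≤ ‖w t‖ ^ 2 := by
    rw [h2]; linarith [sq_nonneg ‖c t‖]
  have hw := h.norm_velocity_pos hf hT htT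
  have h4 : f ^ 2 * ((‖w t‖ ^ 2)⁻¹ * (Complex.log (relPos c w t)).re) ≤ f * t⁻¹ := by
    calc _ ≤ f ^ 2 * ((‖w t‖ ^ 2)⁻¹ * 1) := by gcongr
      _ ≤ f ^ 2 * ((2 * f * t)⁻¹ * 1) := by gcongr
      _ = f * t⁻¹ / 2 := by field_simp
      _ ≤ f * t⁻¹ := half_le_self (by positivity)
  have h5 : 0 ≤ f * t⁻¹ := by positivity
  have h6 := mul_le_mul_of_nonneg_left h3 hf.le
  have h7 := le_abs_self K
  simp only [adiabaticInvariant] at h1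
  simp only [K, adiabaticInvariant] at h7 ⊢
  linarith

lemma hasDerivAt_norm_velocity (h : IsGuidingCenterSolution f T c w) (hf : 0 < f)
    (hT : 0 ≤ T) (ht : T < t) :
    HasDerivAt (fun t => ‖w t‖) (f * ((relPos c w t)⁻¹).re / ‖w t‖) t := by
  have hw := h.norm_velocity_pos hf hT ht
  have h1 := (h.hasDerivAt_norm_velocity_sq hf hT ht).sqrt (by positivity)
  simp only [Real.sqrt_sq (norm_nonneg _)] at h1
  refine h1.congr_deriv ?_
  field_simp

/-- The direction of the velocity in the frame rotating with unit angular speed. -/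
def rotatingDir (w : ℝ → ℂ) (t : ℝ) : ℂ := exp (-(t * I)) * (w t / ‖w t‖)

lemma norm_rotatingDir (hw : w t ≠ 0) : ‖rotatingDir w t‖ = 1 := by
  have : ‖exp (-(t * I))‖ = 1 := by
    have := norm_exp_ofReal_mul_I (-t)
    rwa [ofReal_neg, neg_mul] at this
  rw [rotatingDir, norm_mul, this, norm_div, norm_real, norm_norm,
    div_self (norm_ne_zero_iff.2 hw), one_mul]

lemma hasDerivAt_rotatingDir (h : IsGuidingCenterSolution f T c w) (hf : 0 < f)
    (hT : 0 ≤ T) (ht : T < t) :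
    HasDerivAt (rotatingDir w) (rotatingDir w t *
      ((f / ‖w t‖ ^ 2 : ℝ) * (-I * ((relPos c w t)⁻¹).im))) t := by
  have hw := h.norm_velocity_pos hf hT ht
  have hw' : (‖w t‖ : ℂ) ≠ 0 := ofReal_ne_zero.2 hw.ne'
  have he : HasDerivAt (fun t : ℝ => exp (-(t * I))) (exp (-(t * I)) * (-(1 * I))) t :=
    (((hasDerivAt_id t).ofReal_comp.mul_const I).neg).cexp
  refine (he.mul ((h.hasDerivAt_velocity' hf hT ht).div
    (h.hasDerivAt_norm_velocity hf hT ht).ofReal_comp hw')).congr_deriv ?_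
  have h1 : (conj (relPos c w t))⁻¹ =
      ((relPos c w t)⁻¹).re - ((relPos c w t)⁻¹).im * I := by
    rw [← map_inv₀]
    apply Complex.ext <;> simp [neg_div]
  rw [h1]
  simp only [rotatingDir, Pi.div_apply]
  push_cast
  field_simp
  ring

lemma eventually_norm_velocity_ge (h : IsGuidingCenterSolution f T c w) :
    ∀ᶠ t in atTop, Real.sqrt (2 * f * t) ≤ ‖w t‖ := by
  filter_upwards [eventually_gt_atTop T] with t ht
  apply Real.sqrt_le_iff.2 ⟨norm_nonneg _, _⟩
  rw [h.norm_velocity_sq t ht]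
  linarith [sq_nonneg ‖c t‖]

lemma tendsto_relPos (h : IsGuidingCenterSolution f T c w) (hf : 0 < f) (hT : 0 ≤ T) :
    Tendsto (relPos c w) atTop (𝓝 1) := by
  obtain ⟨C, hC, hb⟩ := h.exists_norm_center_le hf hT
  rw [tendsto_iff_norm_sub_tendsto_zero]
  have hlim : Tendsto (fun t => C / Real.sqrt (2 * f * t)) atTop (𝓝 0) :=
    (Real.tendsto_sqrt_atTop.comp
      (tendsto_id.const_mul_atTop (by positivity : 0 < 2 * f))).const_div_atTop C
  refine squeeze_zero' (Eventually.of_forall fun _ => norm_nonneg _) ?_ hlim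
  filter_upwards [h.eventually_norm_velocity_ge, eventually_gt_atTop (T + 1)] with t hw ht
  have htp : 0 < t := by linarith
  rw [norm_relPos_sub_one]
  exact div_le_div₀ hC (hb t ht) (by positivity) hw

lemma exists_tendsto_rotatingDir (h : IsGuidingCenterSolution f T c w) (hf : 0 < f)
    (hT : 0 ≤ T) : ∃ z, ‖z‖ = 1 ∧ Tendsto (rotatingDir w) atTop (𝓝 z) := by
  obtain ⟨C, hC, hb⟩ := h.exists_norm_center_le hf hT
  have hev : ∀ᶠ t in atTop, ‖deriv (rotatingDir w) t‖ ≤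
      C / Real.sqrt (2 * f) * t ^ (-(3 / 2) : ℝ) := by
    filter_upwards [h.eventually_norm_velocity_ge, eventually_gt_atTop (T + 1),
      (h.tendsto_relPos hf hT).norm.eventually_const_le
        (show (1 / 2 : ℝ) < ‖(1 : ℂ)‖ by norm_num)] with t hw ht ha
    have htp : 0 < t := by linarith
    have htT : T < t := by linarith
    have ha0 := h.relPos_ne_zero hf hT htT
    rw [(h.hasDerivAt_rotatingDir hf hT htT).deriv, norm_mul,
      norm_rotatingDir (h.velocity_ne_zero hf hT htT), one_mul, norm_mul, norm_mul, norm_neg,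
      norm_I, one_mul, norm_real, norm_real, Real.norm_of_nonneg (by positivity)]
    have h1 : ‖((relPos c w t)⁻¹).im‖ ≤ 2 * (C / Real.sqrt (2 * f * t)) := by
      have h2 : ((relPos c w t)⁻¹).im = (-((relPos c w t - 1) / relPos c w t)).im := by
        rw [sub_div, div_self ha0]; simp
      rw [h2]
      refine (abs_im_le_norm _).trans ?_
      rw [norm_neg, norm_div, norm_relPos_sub_one]
      calc ‖c t‖ / ‖w t‖ / ‖relPos c w t‖ ≤ C / Real.sqrt (2 * f * t) / (1 / 2) := by
            refine div_le_div₀ (by positivity) ?_ (by norm_num) ha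
            exact div_le_div₀ hC (hb t ht) (by positivity) hw
        _ = _ := by ring
    have h3 : f / ‖w t‖ ^ 2 ≤ f / (2 * f * t) := by
      gcongr
      exact (Real.sqrt_le_iff.1 hw).2
    calc f / ‖w t‖ ^ 2 * ‖((relPos c w t)⁻¹).im‖
        ≤ f / (2 * f * t) * (2 * (C / Real.sqrt (2 * f * t))) := by gcongr
      _ = _ := by
        have h4 : t ^ (-(3 / 2) : ℝ) = t⁻¹ * (Real.sqrt t)⁻¹ := by
          rw [Real.sqrt_eq_rpow, ← Real.rpow_neg_one, ← Real.rpow_neg htp.le,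
            ← Real.rpow_add htp]
          norm_num
        rw [h4, Real.sqrt_mul (by positivity)]
        field_simp
  obtain ⟨S, hS⟩ := eventually_atTop.1 hev
  set A := max (max S T) 1
  have hA : 0 < A := lt_max_of_lt_right one_pos
  have hint : MeasureTheory.IntegrableOn (deriv (rotatingDir w)) (Ioi A) := by
    refine MeasureTheory.Integrable.mono'
      ((integrableOn_Ioi_rpow_of_lt (by norm_num : (-(3 / 2) : ℝ) < -1) hA).const_mul
        (C / Real.sqrt (2 * f))) (aestronglyMeasurable_deriv _ _) ?_
    filter_upwards [MeasureTheory.ae_restrict_mem measurableSet_Ioi] with t ht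
    exact hS t (((le_max_left _ _).trans (le_max_left _ _)).trans (le_of_lt ht))
  have hTt : ∀ t, A < t → T < t := fun t ht =>
    ((le_max_right _ _).trans (le_max_left _ _)).trans_lt ht
  have hlim := MeasureTheory.tendsto_limUnder_of_hasDerivAt_of_integrableOn_Ioi
    (fun t ht => (h.hasDerivAt_rotatingDir hf hT (hTt t ht)).differentiableAt.hasDerivAt) hint
  refine ⟨_, tendsto_nhds_unique hlim.norm (tendsto_const_nhds.congr' ?_), hlim⟩
  filter_upwards [eventually_gt_atTop A] with t ht
  exact (norm_rotatingDir (h.velocity_ne_zero hf hT (hTt t ht))).symm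

lemma tendsto_norm_position_sq_div (h : IsGuidingCenterSolution f T c w) (hf : 0 < f)
    (hT : 0 ≤ T) :
    Tendsto (fun t => ‖c t + I * w t‖ ^ 2 / t) atTop (𝓝 (2 * f)) := by
  obtain ⟨C, hC, hb⟩ := h.exists_norm_center_le hf hT
  have hc : Tendsto (fun t => ‖c t‖ ^ 2 / t) atTop (𝓝 0) := by
    refine squeeze_zero' ?_ ?_ ((tendsto_id (α := ℝ)).const_div_atTop (C ^ 2))
    · filter_upwards [eventually_ge_atTop 0] with t ht
      positivity
    · filter_upwards [eventually_gt_atTop (T + 1)] with t ht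
      have := hb t ht
      have : 0 ≤ t := by linarith
      simp only [id]
      gcongr
  have h1 := ((h.tendsto_relPos hf hT).norm.pow 2).mul (hc.add_const (2 * f))
  rw [norm_one, one_pow, one_mul, zero_add] at h1
  refine h1.congr' ?_
  filter_upwards [eventually_gt_atTop T] with t ht
  have htp : 0 < t := hT.trans_lt ht
  rw [position_eq (h.velocity_ne_zero hf hT ht), norm_mul, norm_mul, norm_I, one_mul, mul_pow,
    h.norm_velocity_sq t ht]
  field_simp

lemma exists_tendsto_direction (h : IsGuidingCenterSolution f T c w) (hf : 0 < f)
    (hT : 0 ≤ T) :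
    ∃ δ : ℝ, Tendsto (fun t : ℝ => (c t + I * w t) / ‖c t + I * w t‖ - exp ((t + δ : ℝ) * I))
      atTop (𝓝 0) := by
  obtain ⟨z, hz, hlim⟩ := h.exists_tendsto_rotatingDir hf hT
  have hδ : exp (arg (I * z) * I) = I * z := by
    have := norm_mul_exp_arg_mul_I (I * z)
    rwa [norm_mul, norm_I, hz, one_mul, ofReal_one, one_mul] at this
  refine ⟨arg (I * z), ?_⟩
  have ha := h.tendsto_relPos hf hT
  have h1 := ((hlim.const_mul I).mul (ha.div ((continuous_ofReal.tendsto _).comp ha.norm)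
    (by simp))).sub_const (I * z)
  rw [norm_one, ofReal_one, div_one, mul_one, sub_self] at h1
  rw [tendsto_zero_iff_norm_tendsto_zero] at h1 ⊢
  refine h1.congr' ?_
  filter_upwards [eventually_gt_atTop T] with t ht
  have hw := h.velocity_ne_zero hf hT ht
  have h2 : (c t + I * w t) / ‖c t + I * w t‖ - exp ((t + arg (I * z) : ℝ) * I) =
      exp (t * I) * (I * rotatingDir w t *
        (relPos c w t / ((fun x : ℝ => (x : ℂ)) ∘ fun x => ‖relPos c w x‖) t) - I * z) := by
    rw [ofReal_add, add_mul, exp_add, hδ, position_eq hw, rotatingDir, exp_neg]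
    have := exp_ne_zero (t * I)
    have := h.relPos_ne_zero hf hT ht
    simp only [norm_mul, norm_I, one_mul, ofReal_mul, Function.comp_apply]
    field_simp
  rw [h2, norm_mul, norm_exp_ofReal_mul_I, one_mul]
  rfl

end IsGuidingCenterSolution

lemma norm_equivRealProdCLM_symm (p : ℝ × ℝ) : ‖equivRealProdCLM.symm p‖ = nrm p := by
  rw [nrm, norm_def, normSq_apply]
  simp [sq]

/-- Newton's equation in complex notation. -/
lemma equivRealProdCLM_symm_force (f : ℝ) (p v : ℝ × ℝ) :
    equivRealProdCLM.symm (-perp v + (f / (p.1 ^ 2 + p.2 ^ 2)) • perp p) =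
      -(I * equivRealProdCLM.symm v) + I * (f / conj (equivRealProdCLM.symm p)) := by
  have h : normSq (equivRealProdCLM.symm p) = p.1 ^ 2 + p.2 ^ 2 := by
    rw [normSq_apply]; simp [sq]
  rw [div_eq_mul_inv f, div_eq_mul_inv (f : ℂ), ← map_inv₀, inv_def, h, map_mul,
    conj_conj, conj_ofReal]
  generalize (p.1 ^ 2 + p.2 ^ 2)⁻¹ = r
  apply Complex.ext <;> simp [perp] <;> ring

/-- The integral of motion coming from the rotational symmetry. -/
lemma exists_angular_momentum_eq {f sstar : ℝ} {q q' : ℝ → ℝ × ℝ}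
    (hq0 : ∀ s < sstar, q s ≠ 0) (hq : ∀ s < sstar, HasDerivAt q (q' s) s)
    (hNewton : ∀ s < sstar, HasDerivAt q'
      (-perp (q' s) + (f / ((q s).1 ^ 2 + (q s).2 ^ 2)) • perp (q s)) s) :
    ∃ k, ∀ s < sstar, 2 * f * s - ((q s).1 ^ 2 + (q s).2 ^ 2) -
      2 * ((q s).1 * (q' s).2 - (q s).2 * (q' s).1) = k := by
  have hd : ∀ s < sstar, HasDerivAt (fun s => 2 * f * s - ((q s).1 ^ 2 + (q s).2 ^ 2) -
      2 * ((q s).1 * (q' s).2 - (q s).2 * (q' s).1)) 0 s := by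
    intro s hs
    have h1 : HasDerivAt (fun s => (q s).1) _ s := hasFDerivAt_fst.comp_hasDerivAt s (hq s hs)
    have h2 : HasDerivAt (fun s => (q s).2) _ s := hasFDerivAt_snd.comp_hasDerivAt s (hq s hs)
    have h3 : HasDerivAt (fun s => (q' s).1) _ s :=
      hasFDerivAt_fst.comp_hasDerivAt s (hNewton s hs)
    have h4 : HasDerivAt (fun s => (q' s).2) _ s :=
      hasFDerivAt_snd.comp_hasDerivAt s (hNewton s hs)
    refine ((((hasDerivAt_id s).const_mul (2 * f)).sub ((h1.pow 2).add (h2.pow 2))).sub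
      (((h1.mul h4).sub (h2.mul h3)).const_mul 2)).congr_deriv ?_
    have hne : (q s).1 ^ 2 + (q s).2 ^ 2 ≠ 0 := by
      intro h0
      have h5 : (q s).1 = 0 := by nlinarith [sq_nonneg (q s).1, sq_nonneg (q s).2]
      have h6 : (q s).2 = 0 := by nlinarith [sq_nonneg (q s).1, sq_nonneg (q s).2]
      exact hq0 s hs (Prod.ext h5 h6)
    simp [perp]
    field_simp
    ring
  exact isOpen_Iio.exists_is_const_of_deriv_eq_zero isPreconnected_Iio
    (fun s hs => (hd s hs).differentiableAt.differentiableWithinAt) (fun s hs => (hd s hs).deriv)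

lemma exists_isGuidingCenterSolution {f sstar : ℝ} (hf : 0 < f) {q q' : ℝ → ℝ × ℝ}
    (hq0 : ∀ s < sstar, q s ≠ 0) (hq : ∀ s < sstar, HasDerivAt q (q' s) s)
    (hNewton : ∀ s < sstar, HasDerivAt q'
      (-perp (q' s) + (f / ((q s).1 ^ 2 + (q s).2 ^ 2)) • perp (q s)) s) :
    ∃ (T κ : ℝ) (c w : ℝ → ℂ), 0 ≤ T ∧ IsGuidingCenterSolution f T c w ∧
      ∀ t, c t + I * w t = equivRealProdCLM.symm (q (κ - t)) := by
  obtain ⟨k, hk⟩ := exists_angular_momentum_eq hq0 hq hNewton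
  set κ := k / (2 * f)
  set Q : ℝ → ℂ := fun s => equivRealProdCLM.symm (q s)
  set P : ℝ → ℂ := fun s => equivRealProdCLM.symm (q' s)
  have hlt : ∀ t, max 0 (κ - sstar) < t → κ - t < sstar := fun t ht => by
    linarith [(le_max_right 0 (κ - sstar)).trans_lt ht]
  have hQ : ∀ s < sstar, HasDerivAt Q (P s) s := fun s hs =>
    equivRealProdCLM.symm.hasFDerivAt.comp_hasDerivAt s (hq s hs)
  have hP : ∀ s < sstar, HasDerivAt P (-(I * P s) + I * (f / conj (Q s))) s := fun s hs => by
    have := equivRealProdCLM.symm.hasFDerivAt.comp_hasDerivAt s (hNewton s hs)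
    exact this.congr_deriv (equivRealProdCLM_symm_force f (q s) (q' s))
  have hs : ∀ t, HasDerivAt (fun t => κ - t) (-1) t := fun t => (hasDerivAt_id t).const_sub κ
  have hpos : ∀ t, Q (κ - t) - I * P (κ - t) + I * P (κ - t) = Q (κ - t) := fun t => by ring
  refine ⟨max 0 (κ - sstar), κ, fun t => Q (κ - t) - I * P (κ - t), fun t => P (κ - t),
    le_max_left _ _, ⟨fun t ht => ?_, fun t ht => ?_, fun t ht => ?_⟩, hpos⟩
  · refine (((hQ _ (hlt t ht)).scomp t (hs t)).sub
      (((hP _ (hlt t ht)).scomp t (hs t)).const_mul I)).congr_deriv ?_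
    rw [hpos]
    simp only [neg_smul, one_smul]
    linear_combination (-P (κ - t) + f / conj (Q (κ - t))) * I_sq
  · refine ((hP _ (hlt t ht)).scomp t (hs t)).congr_deriv ?_
    rw [hpos]
    simp only [neg_smul, one_smul]
    ring
  · have h1 := hk _ (hlt t ht)
    have h2 : 2 * f * κ = k := by simp only [κ]; field_simp
    rw [← normSq_eq_norm_sq, ← normSq_eq_norm_sq, normSq_apply, normSq_apply]
    simp [Q, P]
    linarith

/-- inward spiral in the past.  For any C² solution
`q : (−∞,s*] → ℝ²∖{0}` of `q̈ = −q̇^⊥ + f·q^⊥/|q|²` one has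
`|q(s)|/√|s| → √(2f)` as `s → −∞`, and there is a phase `δ` such that
`q(s)/|q(s)| − e(−s+δ) → 0` as `s → −∞` (with `e(θ) = (cos θ, sin θ)`): the particle
spirals inward, its direction rotating clockwise with unit angular speed. -/
theorem inward_spiral_past
    (f : ℝ) (hf : 0 < f)
    (sstar : ℝ) (q q' : ℝ → ℝ × ℝ)
    (hq0 : ∀ s ∈ Iic sstar, q s ≠ 0)
    (hq : ∀ s ∈ Iic sstar, HasDerivWithinAt q (q' s) (Iic sstar) s)
    (hNewton : ∀ s ∈ Iic sstar, HasDerivWithinAt q'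
      (-perp (q' s) + (f / ((q s).1 ^ 2 + (q s).2 ^ 2)) • perp (q s)) (Iic sstar) s) :
    Tendsto (fun s : ℝ => nrm (q s) / Real.sqrt |s|) atBot (𝓝 (Real.sqrt (2 * f))) ∧
    ∃ δ : ℝ,
      Tendsto (fun s : ℝ => (nrm (q s))⁻¹ • q s - (Real.cos (-s + δ), Real.sin (-s + δ)))
        atBot (𝓝 (0 : ℝ × ℝ)) := by
  obtain ⟨T, κ, c, w, hT, h, hpos⟩ := exists_isGuidingCenterSolution hf
    (fun s hs => hq0 s (le_of_lt hs))
    (fun s hs => (hq s (le_of_lt hs)).hasDerivAt (Iic_mem_nhds hs))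
    (fun s hs => (hNewton s (le_of_lt hs)).hasDerivAt (Iic_mem_nhds hs))
  have htime : Tendsto (fun s : ℝ => κ - s) atBot atTop :=
    tendsto_atTop_add_const_left _ κ tendsto_neg_atBot_atTop
  constructor
  · have h1 := (h.tendsto_norm_position_sq_div hf hT).comp htime
    have h2 : Tendsto (fun s : ℝ => 1 + κ * (-s)⁻¹) atBot (𝓝 1) := by
      simpa using ((tendsto_inv_atTop_zero.comp tendsto_neg_atBot_atTop).const_mul κ).const_add 1
    have h3 := (h1.mul h2).sqrt
    rw [mul_one] at h3
    refine h3.congr' ?_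
    filter_upwards [eventually_lt_atBot 0, htime.eventually_gt_atTop 0] with s hs hs'
    have hs1 : 0 < -s := by linarith
    simp only [Function.comp_apply, hpos, sub_sub_cancel, norm_equivRealProdCLM_symm]
    have h4 : nrm (q s) ^ 2 / (κ - s) * (1 + κ * (-s)⁻¹) = nrm (q s) ^ 2 / |s| := by
      rw [abs_of_neg hs]
      have : s ≠ 0 := hs.ne
      field_simp
      ring
    rw [h4, Real.sqrt_div (sq_nonneg _), Real.sqrt_sq (show 0 ≤ nrm (q s) from Real.sqrt_nonneg _)]
  · obtain ⟨δ, hδ⟩ := h.exists_tendsto_direction hf hT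
    refine ⟨κ + δ, ?_⟩
    have h1 := (equivRealProdCLM.continuous.tendsto 0).comp (hδ.comp htime)
    rw [map_zero] at h1
    refine h1.congr fun s => ?_
    simp only [Function.comp_apply, hpos, sub_sub_cancel, norm_equivRealProdCLM_symm]
    have h2 : -s + (κ + δ) = κ - s + δ := by ring
    rw [h2, div_eq_inv_mul, ← ofReal_inv]
    ext
    · rw [Prod.fst_sub, equivRealProdCLM_apply, sub_re, exp_ofReal_mul_I_re]
      simp
    · rw [Prod.snd_sub, equivRealProdCLM_apply, sub_im, exp_ofReal_mul_I_im]
      simp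
end
end
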